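/- arXiv:1404.1098 — 15 statements merged into one kernel-verified Lean document; each statement's English description precedes it below -/
import Mathlib

section
/- Let c ∈ [1,3]. There exists a constant C depending only on c such that for every u ∈ H^{c-1}, v ∈ H^1 and w ∈ H one has Σ_{j≥0} ( 2^{cj} |u_j v_{j+1} w_j| + 2^{c(j-1)} |u_{j-1} v_{j-1} w_j| ) ≤ C |u|_{H^{c-1}} |v|_{H^1} |w| (convention u_{-1} = v_{-1} = 0). In particular B(u,v) ∈ H and |⟨B(u,v), w⟩| ≤ C |u|_{H^{c-1}} |v|_{H^1} |w|. -/
open scoped BigOperators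

/-- The `H^α` norm of a sequence: `|u|_{H^α} = (∑_j 2^{2αj} u_j²)^{1/2}`. -/
noncomputable def Hnorm (α : ℝ) (u : ℕ → ℝ) : ℝ :=
  Real.sqrt (∑' j : ℕ, (2:ℝ) ^ (2 * α * (j:ℝ)) * u j ^ 2)

/-- The shell-model bilinear operator `B(u,v)_j = 2^{cj} u_j v_{j+1} - 2^{c(j-1)} u_{j-1} v_{j-1}`,
with the convention `u_{-1} = v_{-1} = 0`. -/
noncomputable def Bop (c : ℝ) (u v : ℕ → ℝ) : ℕ → ℝ := fun j =>
  (2:ℝ) ^ (c * (j:ℝ)) * u j * v (j+1)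
    - (if j = 0 then 0 else (2:ℝ) ^ (c * ((j:ℝ) - 1)) * u (j-1) * v (j-1))

lemma cs_aux (f g : ℕ → ℝ) (hf0 : ∀ j, 0 ≤ f j) (hg0 : ∀ j, 0 ≤ g j)
    (hf : Summable (fun j => f j ^ 2)) (hg : Summable (fun j => g j ^ 2)) :
    Summable (fun j => f j * g j) ∧
      ∑' j, f j * g j ≤ Real.sqrt (∑' j, f j ^ 2) * Real.sqrt (∑' j, g j ^ 2) := by
  have key : ∀ s : Finset ℕ, ∑ j ∈ s, f j * g j ≤
      Real.sqrt (∑' j, f j ^ 2) * Real.sqrt (∑' j, g j ^ 2) := by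
    intro s
    refine (Real.sum_mul_le_sqrt_mul_sqrt s f g).trans ?_
    have h1 := hf.sum_le_tsum s (fun j _ => sq_nonneg (f j))
    have h2 := hg.sum_le_tsum s (fun j _ => sq_nonneg (g j))
    exact mul_le_mul (Real.sqrt_le_sqrt h1) (Real.sqrt_le_sqrt h2)
      (Real.sqrt_nonneg _) (Real.sqrt_nonneg _)
  have h0 : ∀ j, 0 ≤ f j * g j := fun j => mul_nonneg (hf0 j) (hg0 j)
  exact ⟨summable_of_sum_le h0 key, Real.tsum_le_of_sum_le h0 key⟩

lemma wsq_aux (α : ℝ) (u : ℕ → ℝ) (j : ℕ) :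
    (2:ℝ) ^ (2 * α * (j:ℝ)) * u j ^ 2 = ((2:ℝ) ^ (α * (j:ℝ)) * |u j|) ^ 2 := by
  rw [mul_pow, sq_abs, ← Real.rpow_natCast ((2:ℝ) ^ (α * (j:ℝ))), ← Real.rpow_mul (by norm_num)]
  congr 2
  push_cast
  ring

lemma shift_aux (A : ℕ → ℝ) (hA : Summable (fun j => A j ^ 2)) :
    Summable (fun j : ℕ => (if j = 0 then 0 else A (j-1)) ^ 2) ∧
      ∑' j : ℕ, (if j = 0 then 0 else A (j-1)) ^ 2 = ∑' j, A j ^ 2 := by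
  have h : Summable (fun j : ℕ => (if j = 0 then 0 else A (j-1)) ^ 2) := by
    rw [← summable_nat_add_iff 1]
    simpa using hA
  refine ⟨h, ?_⟩
  rw [h.tsum_eq_zero_add]
  simp

theorem stmt0 (c : ℝ) (hc : c ∈ Set.Icc (1:ℝ) 3) :
    ∃ C : ℝ, 0 < C ∧ ∀ u v w : ℕ → ℝ,
      Summable (fun j : ℕ => (2:ℝ) ^ (2 * (c-1) * (j:ℝ)) * u j ^ 2) →
      Summable (fun j : ℕ => (2:ℝ) ^ (2 * (1:ℝ) * (j:ℝ)) * v j ^ 2) →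
      Summable (fun j : ℕ => w j ^ 2) →
      Summable (fun j : ℕ =>
          (2:ℝ) ^ (c * (j:ℝ)) * |u j * v (j+1) * w j|
          + (if j = 0 then 0 else (2:ℝ) ^ (c * ((j:ℝ) - 1)) * |u (j-1) * v (j-1) * w j|)) ∧
      (∑' j : ℕ,
          ((2:ℝ) ^ (c * (j:ℝ)) * |u j * v (j+1) * w j|
          + (if j = 0 then 0 else (2:ℝ) ^ (c * ((j:ℝ) - 1)) * |u (j-1) * v (j-1) * w j|)))
        ≤ C * Hnorm (c-1) u * Hnorm 1 v * Hnorm 0 w ∧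
      Summable (fun j : ℕ => (Bop c u v j) ^ 2) ∧
      |∑' j : ℕ, Bop c u v j * w j| ≤ C * Hnorm (c-1) u * Hnorm 1 v * Hnorm 0 w := by
  refine ⟨2, by norm_num, ?_⟩
  intro u v w hu hv hw
  set A : ℕ → ℝ := fun j => (2:ℝ) ^ ((c-1) * (j:ℝ)) * |u j| with hAdef
  set A' : ℕ → ℝ := fun j => if j = 0 then 0 else A (j-1) with hA'def
  set V : ℝ := Hnorm 1 v with hVdef
  have hA0 : ∀ j, 0 ≤ A j := fun j => by positivity
  have hA'0 : ∀ j, 0 ≤ A' j := fun j => by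
    simp only [hA'def]; split_ifs
    · exact le_rfl
    · exact hA0 _
  have hV0 : 0 ≤ V := Real.sqrt_nonneg _
  have hA2 : Summable (fun j => A j ^ 2) := by
    simpa only [wsq_aux] using hu
  obtain ⟨hA'2, hA't⟩ := shift_aux A hA2
  have hU : Hnorm (c-1) u = Real.sqrt (∑' j, A j ^ 2) := by
    simp only [Hnorm, wsq_aux, hAdef]
  have hW : Hnorm 0 w = Real.sqrt (∑' j, |w j| ^ 2) := by
    simp [Hnorm]
  have hw2 : Summable (fun j => |w j| ^ 2) := by simpa using hw
  have hvb : ∀ j : ℕ, (2:ℝ) ^ (j:ℝ) * |v j| ≤ V := by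
    intro j
    apply Real.le_sqrt_of_sq_le
    have h1 := hv.le_tsum j (fun i _ => by positivity)
    have h2 := wsq_aux 1 v j
    rw [one_mul] at h2
    rw [← h2]
    exact h1
  have hsplit : ∀ j : ℕ, (2:ℝ) ^ (c * (j:ℝ)) = (2:ℝ) ^ ((c-1) * (j:ℝ)) * (2:ℝ) ^ (j:ℝ) := by
    intro j
    rw [← Real.rpow_add (by norm_num)]
    congr 1; ring
  have b1 : ∀ j : ℕ, (2:ℝ) ^ (c * (j:ℝ)) * |u j * v (j+1)| ≤ V * A j := by
    intro j
    have h : (2:ℝ) ^ (j:ℝ) * |v (j+1)| ≤ V := by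
      refine le_trans ?_ (hvb (j+1))
      gcongr
      · norm_num
      · simp
    rw [hsplit, abs_mul]
    calc _ = A j * ((2:ℝ) ^ (j:ℝ) * |v (j+1)|) := by simp only [hAdef]; ring
      _ ≤ A j * V := mul_le_mul_of_nonneg_left h (hA0 j)
      _ = _ := mul_comm _ _
  have b2 : ∀ j : ℕ, (if j = 0 then 0 else (2:ℝ) ^ (c * ((j:ℝ) - 1)) * |u (j-1) * v (j-1)|)
      ≤ V * A' j := by
    intro j
    rcases j with _ | j
    · simp [hA'def]
    · have e : (((j+1 : ℕ) : ℝ) - 1) = (j:ℝ) := by push_cast; ring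
      simp only [hA'def, Nat.add_one_ne_zero, if_false, Nat.add_sub_cancel, e]
      rw [hsplit, abs_mul]
      calc _ = A j * ((2:ℝ) ^ (j:ℝ) * |v j|) := by simp only [hAdef]; ring
        _ ≤ A j * V := mul_le_mul_of_nonneg_left (hvb j) (hA0 j)
        _ = _ := mul_comm _ _
  obtain ⟨s1, t1⟩ := cs_aux A (fun j => |w j|) hA0 (fun j => abs_nonneg _) hA2 hw2
  obtain ⟨s2, t2⟩ := cs_aux A' (fun j => |w j|) hA'0 (fun j => abs_nonneg _) hA'2 hw2
  rw [hA't] at t2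
  rw [← hU, ← hW] at t1 t2
  set T : ℕ → ℝ := fun j : ℕ =>
          (2:ℝ) ^ (c * (j:ℝ)) * |u j * v (j+1) * w j|
          + (if j = 0 then 0 else (2:ℝ) ^ (c * ((j:ℝ) - 1)) * |u (j-1) * v (j-1) * w j|) with hT
  have hTeq : ∀ j, T j = ((2:ℝ) ^ (c * (j:ℝ)) * |u j * v (j+1)|
      + (if j = 0 then 0 else (2:ℝ) ^ (c * ((j:ℝ) - 1)) * |u (j-1) * v (j-1)|)) * |w j| := by
    intro j
    simp only [hT, abs_mul]
    split_ifs <;> ring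
  have hT0 : ∀ j, 0 ≤ T j := by
    intro j
    simp only [hT]
    split_ifs <;> positivity
  have hTle : ∀ j, T j ≤ V * (A j * |w j| + A' j * |w j|) := by
    intro j
    rw [hTeq]
    calc _ ≤ (V * A j + V * A' j) * |w j| :=
          mul_le_mul_of_nonneg_right (add_le_add (b1 j) (b2 j)) (abs_nonneg _)
      _ = _ := by ring
  have hsS : Summable (fun j => V * (A j * |w j| + A' j * |w j|)) := (s1.add s2).mul_left V
  have hTs : Summable T := Summable.of_nonneg_of_le hT0 hTle hsS
  have hTt : ∑' j, T j ≤ 2 * Hnorm (c-1) u * V * Hnorm 0 w := by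
    refine (hTs.tsum_le_tsum hTle hsS).trans ?_
    rw [tsum_mul_left, s1.tsum_add s2]
    have := mul_le_mul_of_nonneg_left (add_le_add t1 t2) hV0
    refine this.trans (le_of_eq ?_)
    ring
  have hB : ∀ j, |Bop c u v j| ≤ (2:ℝ) ^ (c * (j:ℝ)) * |u j * v (j+1)|
      + (if j = 0 then 0 else (2:ℝ) ^ (c * ((j:ℝ) - 1)) * |u (j-1) * v (j-1)|) := by
    intro j
    unfold Bop
    refine (abs_sub _ _).trans (le_of_eq ?_)
    have p : ∀ x : ℝ, |(2:ℝ) ^ x| = (2:ℝ) ^ x := fun x => abs_of_pos (by positivity)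
    split_ifs
    · simp only [abs_mul, p, abs_zero]; ring
    · simp only [abs_mul, p]; ring
  refine ⟨hTs, hTt, ?_, ?_⟩
  · refine Summable.of_nonneg_of_le (fun j => sq_nonneg _) (fun j => ?_)
      ((hA2.add hA'2).mul_left (2 * V ^ 2))
    have h := (hB j).trans (add_le_add (b1 j) (b2 j))
    have h2 : Bop c u v j ^ 2 ≤ (V * A j + V * A' j) ^ 2 := by
      rw [← sq_abs]
      exact pow_le_pow_left₀ (abs_nonneg _) h 2
    refine h2.trans ?_
    change _ ≤ 2 * V ^ 2 * (A j ^ 2 + A' j ^ 2)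
    nlinarith [sq_nonneg (V * A j - V * A' j)]
  · have hle : ∀ j, ‖Bop c u v j * w j‖ ≤ T j := by
      intro j
      rw [Real.norm_eq_abs, abs_mul, hTeq]
      exact mul_le_mul_of_nonneg_right (hB j) (abs_nonneg _)
    have := tsum_of_norm_bounded hTs.hasSum hle
    exact (by simpa using this : |∑' j, Bop c u v j * w j| ≤ ∑' j, T j).trans hTt
end

section
/- Let c ∈ [1,3], u ∈ H^{c-1} and v ∈ H^1. Then the series Σ_{j≥0} B(u,v)_j v_j = Σ_{j≥0} ( 2^{cj} u_j v_{j+1} v_j - 2^{c(j-1)} u_{j-1} v_{j-1} v_j ) converges absolutely and its sum equals 0; that is, ⟨B(u,v), v⟩ = 0. -/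
open scoped BigOperators

theorem stmt1 (c : ℝ) (hc : c ∈ Set.Icc (1:ℝ) 3) (u v : ℕ → ℝ)
    (hu : Summable fun j : ℕ => (2:ℝ) ^ (2 * (c-1) * (j:ℝ)) * u j ^ 2)
    (hv : Summable fun j : ℕ => (2:ℝ) ^ (2 * (j:ℝ)) * v j ^ 2) :
    Summable (fun j : ℕ => |Bop c u v j * v j|) ∧
    ∑' j : ℕ, Bop c u v j * v j = 0 := by
  set T : ℕ → ℝ := fun j => (2:ℝ) ^ (c * (j:ℝ)) * u j * v (j+1) * v j with hT
  set M : ℝ := 1 + ∑' j : ℕ, (2:ℝ) ^ (2 * (j:ℝ)) * v j ^ 2 with hM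
  have hvb : ∀ j, |v j| ≤ M := by
    intro j
    have h1 : (2:ℝ) ^ (2 * (j:ℝ)) * v j ^ 2 ≤ ∑' j : ℕ, (2:ℝ) ^ (2 * (j:ℝ)) * v j ^ 2 :=
      hv.le_tsum j (fun i _ => by positivity)
    have h2 : (1:ℝ) ≤ (2:ℝ) ^ (2 * (j:ℝ)) :=
      Real.one_le_rpow (by norm_num) (by positivity)
    have h3 : v j ^ 2 ≤ (2:ℝ) ^ (2 * (j:ℝ)) * v j ^ 2 :=
      le_mul_of_one_le_left (sq_nonneg _) h2
    have h4 : |v j| ^ 2 = v j ^ 2 := sq_abs _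
    nlinarith [sq_nonneg (|v j| - 1), abs_nonneg (v j)]
  have hTabs : Summable (fun j => |T j|) := by
    refine Summable.of_nonneg_of_le (fun j => abs_nonneg _) ?_ ((hu.add hv).mul_left M)
    intro j
    have e1 : (2:ℝ) ^ (c * (j:ℝ)) = (2:ℝ) ^ ((c-1) * (j:ℝ)) * (2:ℝ) ^ (j:ℝ) := by
      rw [← Real.rpow_add (by norm_num)]; congr 1; ring
    have e2 : (2:ℝ) ^ (2 * (c-1) * (j:ℝ)) = ((2:ℝ) ^ ((c-1) * (j:ℝ))) ^ 2 := by
      rw [sq, ← Real.rpow_add (by norm_num)]; congr 1; ring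
    have e3 : (2:ℝ) ^ (2 * (j:ℝ)) = ((2:ℝ) ^ (j:ℝ)) ^ 2 := by
      rw [sq, ← Real.rpow_add (by norm_num)]; congr 1; ring
    rw [e2, e3]
    simp only [hT]
    rw [e1]
    set p := (2:ℝ) ^ ((c-1) * (j:ℝ))
    set q := (2:ℝ) ^ (j:ℝ)
    have e4 : p * q * u j * v (j+1) * v j = v (j+1) * ((p * u j) * (q * v j)) := by ring
    rw [e4, abs_mul]
    refine mul_le_mul (hvb _) ?_ (abs_nonneg _) ((abs_nonneg _).trans (hvb 0))
    rw [abs_le]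
    constructor <;>
      nlinarith [sq_nonneg (p * u j + q * v j), sq_nonneg (p * u j - q * v j),
        sq_nonneg (p * u j), sq_nonneg (q * v j)]
  have hTs : Summable T := hTabs.of_abs
  set G : ℕ → ℝ := fun j => if j = 0 then 0 else T (j-1) with hG
  have hGs : HasSum G (∑' j, T j) := by
    rw [← hasSum_nat_add_iff' 1]
    simpa [hG] using hTs.hasSum
  have hB : (fun j => Bop c u v j * v j) = fun j => T j - G j := by
    funext j
    cases j with
    | zero => simp [Bop, hT, hG]
    | succ n =>
      simp only [Bop, hT, hG, Nat.add_sub_cancel, Nat.succ_ne_zero, if_false]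
      push_cast
      rw [add_sub_cancel_right]
      ring
  have hS : HasSum (fun j => Bop c u v j * v j) 0 := by
    rw [hB]
    simpa using hTs.hasSum.sub hGs
  exact ⟨hS.summable.abs, hS.tsum_eq⟩
end

section
/- Let (Ω, 𝓕, ℙ) be a probability space, let c ∈ ℝ, ν ≥ 0, σ ∈ ℝ, and let (u_j)_{j≥0} be real random variables with 𝔼|u_j|³ < ∞ for every j and u_j ≥ 0 almost surely for every j ≥ 1 (convention u_{-1} := 0). Assume the second-moment stationarity identities: for every j ≥ 0, ν 2^{2j} 𝔼(u_j²) + 2^{cj} 𝔼(u_j² u_{j+1}) = 2^{c(j-1)} 𝔼(u_{j-1}² u_j) + (σ²/2)·1_{j=0}. Then ν Σ_{j=0}^∞ 2^{2j} 𝔼(u_j²) ≤ σ²/2 (the series being convergent when ν > 0), and in particular if ν > 0 then lim_{j→∞} 2^{2j} 𝔼(u_j²) = 0. -/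
open MeasureTheory

theorem stmt4 {Ω : Type*} [MeasurableSpace Ω] (μ : Measure Ω) [IsProbabilityMeasure μ]
    (c ν σ : ℝ) (hν : 0 ≤ ν)
    (u : ℕ → Ω → ℝ)
    (hmeas : ∀ j, AEStronglyMeasurable (u j) μ)
    (hint : ∀ j, Integrable (fun ω => |u j ω| ^ 3) μ)
    (hpos : ∀ j : ℕ, 1 ≤ j → ∀ᵐ ω ∂μ, 0 ≤ u j ω)
    -- the second-moment stationarity identities, with the convention `u_{-1} = 0`
    (hstat : ∀ j : ℕ,
      ν * (2:ℝ) ^ (2 * j) * (∫ ω, (u j ω) ^ 2 ∂μ)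
        + (2:ℝ) ^ (c * (j:ℝ)) * (∫ ω, (u j ω) ^ 2 * u (j+1) ω ∂μ)
      = (if j = 0 then 0 else
          (2:ℝ) ^ (c * ((j:ℝ) - 1)) * (∫ ω, (u (j-1) ω) ^ 2 * u j ω ∂μ))
        + (if j = 0 then σ ^ 2 / 2 else 0)) :
    (∀ N : ℕ,
      ν * (∑ j ∈ Finset.range (N+1), (2:ℝ) ^ (2 * j) * (∫ ω, (u j ω) ^ 2 ∂μ)) ≤ σ ^ 2 / 2) ∧
    (0 < ν →
      Summable (fun j : ℕ => (2:ℝ) ^ (2 * j) * (∫ ω, (u j ω) ^ 2 ∂μ)) ∧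
      ν * (∑' j : ℕ, (2:ℝ) ^ (2 * j) * (∫ ω, (u j ω) ^ 2 ∂μ)) ≤ σ ^ 2 / 2 ∧
      Filter.Tendsto (fun j : ℕ => (2:ℝ) ^ (2 * j) * (∫ ω, (u j ω) ^ 2 ∂μ))
        Filter.atTop (nhds 0)) := by
  have key : ∀ N : ℕ,
      ν * (∑ j ∈ Finset.range (N+1), (2:ℝ) ^ (2 * j) * (∫ ω, (u j ω) ^ 2 ∂μ))
        + (2:ℝ) ^ (c * (N:ℝ)) * (∫ ω, (u N ω) ^ 2 * u (N+1) ω ∂μ) = σ ^ 2 / 2 := by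
    intro N
    induction N with
    | zero =>
      have h := hstat 0
      simp only [if_true] at h
      rw [Finset.sum_range_one]
      linarith
    | succ n ih =>
      have h := hstat (n + 1)
      simp only [Nat.add_one_ne_zero, if_false, Nat.add_sub_cancel] at h
      have e : ((n + 1 : ℕ) : ℝ) - 1 = n := by push_cast; ring
      rw [e] at h
      rw [Finset.sum_range_succ, mul_add]
      linarith
  have flux : ∀ N : ℕ,
      0 ≤ (2:ℝ) ^ (c * (N:ℝ)) * (∫ ω, (u N ω) ^ 2 * u (N+1) ω ∂μ) := by
    intro N
    refine mul_nonneg (by positivity) (integral_nonneg_of_ae ?_)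
    filter_upwards [hpos (N + 1) (by omega)] with ω hω
    exact mul_nonneg (sq_nonneg _) hω
  have part : ∀ N : ℕ,
      ν * (∑ j ∈ Finset.range (N+1), (2:ℝ) ^ (2 * j) * (∫ ω, (u j ω) ^ 2 ∂μ)) ≤ σ ^ 2 / 2 := by
    intro N
    linarith [key N, flux N]
  refine ⟨part, fun hν' => ?_⟩
  have nn : ∀ j : ℕ, 0 ≤ (2:ℝ) ^ (2 * j) * (∫ ω, (u j ω) ^ 2 ∂μ) := fun j =>
    mul_nonneg (by positivity) (integral_nonneg fun ω => sq_nonneg _)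
  have bd : ∀ n : ℕ, ∑ j ∈ Finset.range n, (2:ℝ) ^ (2 * j) * (∫ ω, (u j ω) ^ 2 ∂μ)
      ≤ σ ^ 2 / 2 / ν := by
    intro n
    rw [le_div_iff₀ hν', mul_comm]
    refine le_trans (mul_le_mul_of_nonneg_left ?_ hν) (part n)
    rw [Finset.sum_range_succ]
    linarith [nn n]
  have hs := summable_of_sum_range_le nn bd
  refine ⟨hs, ?_, hs.tendsto_atTop_zero⟩
  have h := Real.tsum_le_of_sum_range_le nn bd
  rw [le_div_iff₀ hν', mul_comm] at h
  exact h
end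

section
/- Let (Ω, 𝓕, ℙ) be a probability space, let c ∈ [1,3], ν ∈ (0,1], σ ∈ ℝ, and let (u_j)_{j≥0} be real random variables with 𝔼|u_j|³ < ∞ for every j and u_j ≥ 0 almost surely for every j ≥ 1 (convention u_{-1} := 0). Assume both the first-moment stationarity identities — for every j ≥ 0, ν 2^{2j} 𝔼(u_j) + 2^{cj} 𝔼(u_j u_{j+1}) = 2^{c(j-1)} 𝔼(u_{j-1}²) — and the second-moment stationarity identities — for every j ≥ 0, ν 2^{2j} 𝔼(u_j²) + 2^{cj} 𝔼(u_j² u_{j+1}) = 2^{c(j-1)} 𝔼(u_{j-1}² u_j) + (σ²/2)·1_{j=0}. Then there exists a constant C depending only on c (in particular independent of ν, σ and the random variables) such that sup_{j≥0} 2^{(c-1)j} 𝔼(u_j²) ≤ C ( ν^{1/2} |σ| + |σ|^{4/3} ). -/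
open MeasureTheory

lemma aux_young (y w B : ℝ) (hw : 0 ≤ w) (hB : 0 ≤ B) (h : y ^ 4 ≤ w ^ 3 * B) :
    y ≤ 3 / 4 * w + B / 4 := by
  have h1 : w ^ 3 * B ≤ (3 / 4 * w + B / 4) ^ 4 := by
    obtain ⟨d, rfl⟩ : ∃ d, B = w + 4 * d := ⟨(B - w) / 4, by ring⟩
    have : 0 ≤ d ^ 2 * ((d + 2 * w) ^ 2 + 2 * w ^ 2) := by positivity
    nlinarith
  exact le_of_pow_le_pow_left₀ (n := 4) (by norm_num) (by positivity) (h.trans h1)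

lemma aux_iter (B : ℕ → ℝ) (D G : ℝ) (hG : ∀ j, B j ≤ G)
    (h : ∀ j, B j ≤ D + B (j + 2) / 4) (j : ℕ) : B j ≤ 4 / 3 * D := by
  have hbdd : BddAbove (Set.range B) := ⟨G, by rintro _ ⟨i, rfl⟩; exact hG i⟩
  have h1 : ∀ i, B i ≤ iSup B := le_ciSup hbdd
  have h2 : iSup B ≤ D + iSup B / 4 := ciSup_le fun i => by
    linarith [h i, h1 (i + 2)]
  linarith [h1 j]

lemma aux_step (ν s w T X k b0 a1 p1 q1 b1 a2 b2 : ℝ) (hν : 0 < ν) (hs : 0 ≤ s) (hw : 0 ≤ w)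
    (hws : w ^ 3 = s ^ 4) (hT : 0 < T) (hX : 0 < X) (hk : 0 < k) (hXT : X ≤ T ^ 3)
    (hq : 0 ≤ q1) (ha2 : 0 ≤ a2) (hb2 : 0 ≤ b2)
    (E1 : ν * (4 * T ^ 2) * a1 + k * X * p1 = X * b0)
    (hb1 : ν * (4 * T ^ 2) * b1 ≤ s ^ 2 / 2) (hq1 : k * X * q1 ≤ s ^ 2 / 2)
    (hp : p1 ^ 2 ≤ q1 * a2) (haa : a2 ^ 2 ≤ b2) (hab : a1 ^ 2 ≤ b1) :
    X / T * b0 ≤ (3 / 2 * (Real.sqrt ν * s) + 3 / 4 * w) + (X / T * (k ^ 2 / 4) * b2) / 4 := by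
  have e : X / T * b0 = 4 * ν * T * a1 + k * X * p1 / T := by
    field_simp
    linarith
  have h1 : 4 * ν * T * a1 ≤ 3 / 2 * (Real.sqrt ν * s) := by
    apply le_of_sq_le_sq _ (by positivity)
    have hsq := Real.sq_sqrt hν.le
    calc (4 * ν * T * a1) ^ 2 = 16 * ν ^ 2 * T ^ 2 * a1 ^ 2 := by ring
      _ ≤ 16 * ν ^ 2 * T ^ 2 * b1 := by gcongr
      _ = 4 * ν * (ν * (4 * T ^ 2) * b1) := by ring
      _ ≤ 4 * ν * (s ^ 2 / 2) := by gcongr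
      _ ≤ 9 / 4 * (ν * s ^ 2) := by nlinarith [mul_nonneg hν.le (sq_nonneg s)]
      _ = (3 / 2 * (Real.sqrt ν * s)) ^ 2 := by rw [mul_pow, mul_pow, hsq]; ring
  have h2 : k * X * p1 / T ≤ 3 / 4 * w + (X / T * (k ^ 2 / 4) * b2) / 4 := by
    apply aux_young _ _ _ hw (by positivity)
    rw [hws]
    have hp4 : p1 ^ 4 ≤ q1 ^ 2 * b2 := by
      calc p1 ^ 4 = (p1 ^ 2) ^ 2 := by ring
        _ ≤ (q1 * a2) ^ 2 := by gcongr
        _ = q1 ^ 2 * a2 ^ 2 := by ring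
        _ ≤ q1 ^ 2 * b2 := by gcongr
    calc (k * X * p1 / T) ^ 4 = k ^ 4 * X ^ 4 / T ^ 4 * p1 ^ 4 := by ring
      _ ≤ k ^ 4 * X ^ 4 / T ^ 4 * (q1 ^ 2 * b2) := by gcongr
      _ = k ^ 2 * X * X / T ^ 4 * (k * X * q1) ^ 2 * b2 := by ring
      _ ≤ k ^ 2 * X * T ^ 3 / T ^ 4 * (s ^ 2 / 2) ^ 2 * b2 := by gcongr
      _ = s ^ 4 * (X / T * (k ^ 2 / 4) * b2) := by field_simp; ring
  rw [e]; linarith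

section
variable {Ω : Type} [MeasurableSpace Ω] {μ : Measure Ω} [IsProbabilityMeasure μ]

lemma aux_int1 {f : Ω → ℝ} (hf : AEStronglyMeasurable f μ)
    (h3 : Integrable (fun ω => |f ω| ^ 3) μ) : Integrable f μ := by
  refine ((integrable_const (1 : ℝ)).add h3).mono' hf (.of_forall fun ω => ?_)
  simp only [Pi.add_apply, Real.norm_eq_abs]
  nlinarith [abs_nonneg (f ω), mul_nonneg (abs_nonneg (f ω)) (sq_nonneg (|f ω| - 1)),
    sq_nonneg (|f ω| - 1)]

lemma aux_int2 {f : Ω → ℝ} (hf : AEStronglyMeasurable f μ)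
    (h3 : Integrable (fun ω => |f ω| ^ 3) μ) : Integrable (fun ω => f ω ^ 2) μ := by
  refine ((integrable_const (1 : ℝ)).add h3).mono' (hf.pow 2) (.of_forall fun ω => ?_)
  simp only [Pi.add_apply, Real.norm_eq_abs, abs_pow]
  nlinarith [abs_nonneg (f ω), mul_nonneg (abs_nonneg (f ω)) (sq_nonneg (|f ω| - 1)),
    sq_nonneg (|f ω| - 1)]

lemma aux_int11 {f g : Ω → ℝ} (hf : AEStronglyMeasurable f μ) (hg : AEStronglyMeasurable g μ)
    (h3 : Integrable (fun ω => |f ω| ^ 3) μ) (h3' : Integrable (fun ω => |g ω| ^ 3) μ) :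
    Integrable (fun ω => f ω * g ω) μ := by
  refine ((aux_int2 hf h3).add (aux_int2 hg h3')).mono' (hf.mul hg) (.of_forall fun ω => ?_)
  simp only [Pi.add_apply, Real.norm_eq_abs, abs_mul]
  nlinarith [sq_nonneg (|f ω| - |g ω|), sq_abs (f ω), sq_abs (g ω), sq_nonneg (|f ω| + |g ω|)]

lemma aux_int21 {f g : Ω → ℝ} (hf : AEStronglyMeasurable f μ) (hg : AEStronglyMeasurable g μ)
    (h3 : Integrable (fun ω => |f ω| ^ 3) μ) (h3' : Integrable (fun ω => |g ω| ^ 3) μ) :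
    Integrable (fun ω => f ω ^ 2 * g ω) μ := by
  refine (h3.add h3').mono' ((hf.pow 2).mul hg) (.of_forall fun ω => ?_)
  simp only [Pi.add_apply, Real.norm_eq_abs, abs_mul, abs_pow]
  have ha := abs_nonneg (f ω)
  have hb := abs_nonneg (g ω)
  generalize |f ω| = a at *
  generalize |g ω| = b at *
  rcases le_total a b with h | h
  · have : a ^ 2 * b ≤ b ^ 2 * b := by gcongr
    have : 0 ≤ a ^ 3 := by positivity
    nlinarith
  · have : a ^ 2 * b ≤ a ^ 2 * a := by gcongr
    have : 0 ≤ b ^ 3 := by positivity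
    nlinarith

lemma aux_cs1 {f : Ω → ℝ} (hf : AEStronglyMeasurable f μ)
    (h3 : Integrable (fun ω => |f ω| ^ 3) μ) : (∫ ω, f ω ∂μ) ^ 2 ≤ ∫ ω, f ω ^ 2 ∂μ := by
  have i1 := aux_int1 hf h3
  have i2 := aux_int2 hf h3
  set a := ∫ ω, f ω ∂μ with ha
  have h : 0 ≤ ∫ ω, (f ω - a) ^ 2 ∂μ := integral_nonneg fun ω => sq_nonneg _
  have e : ∫ ω, (f ω - a) ^ 2 ∂μ = ∫ ω, f ω ^ 2 - (2 * a) * f ω + a ^ 2 ∂μ := by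
    congr 1; ext ω; ring
  have i3 : Integrable (fun ω => f ω ^ 2 - (2 * a) * f ω) μ := i2.sub (i1.const_mul _)
  rw [e, integral_add i3 (integrable_const _),
    integral_sub i2 (i1.const_mul _), integral_const_mul, ← ha] at h
  simp at h
  nlinarith

lemma aux_cs2 {f g : Ω → ℝ} (hf : AEStronglyMeasurable f μ) (hg : AEStronglyMeasurable g μ)
    (h3 : Integrable (fun ω => |f ω| ^ 3) μ) (h3' : Integrable (fun ω => |g ω| ^ 3) μ)
    (hg0 : ∀ᵐ ω ∂μ, 0 ≤ g ω) :
    (∫ ω, f ω * g ω ∂μ) ^ 2 ≤ (∫ ω, f ω ^ 2 * g ω ∂μ) * ∫ ω, g ω ∂μ := by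
  have i1 := aux_int1 hg h3'
  have i11 := aux_int11 hf hg h3 h3'
  have i21 := aux_int21 hf hg h3 h3'
  have key : ∀ t : ℝ, 0 ≤ (∫ ω, g ω ∂μ) * (t * t) + (-2 * ∫ ω, f ω * g ω ∂μ) * t
      + ∫ ω, f ω ^ 2 * g ω ∂μ := by
    intro t
    have h : 0 ≤ ∫ ω, (f ω - t) ^ 2 * g ω ∂μ :=
      integral_nonneg_of_ae (hg0.mono fun ω h => mul_nonneg (sq_nonneg _) h)
    have e : ∫ ω, (f ω - t) ^ 2 * g ω ∂μ
        = ∫ ω, f ω ^ 2 * g ω - (2 * t) * (f ω * g ω) + t ^ 2 * g ω ∂μ := by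
      congr 1; ext ω; ring
    have i3 : Integrable (fun ω => f ω ^ 2 * g ω - (2 * t) * (f ω * g ω)) μ :=
      i21.sub (i11.const_mul _)
    rw [e, integral_add i3 (i1.const_mul _),
      integral_sub i21 (i11.const_mul _), integral_const_mul, integral_const_mul] at h
    linarith
  have := discrim_le_zero key
  unfold discrim at this
  linarith
end

theorem stmt5 (c : ℝ) (hc : c ∈ Set.Icc (1:ℝ) 3) :
    ∃ C : ℝ, 0 < C ∧
      ∀ (Ω : Type) [MeasurableSpace Ω] (μ : Measure Ω) [IsProbabilityMeasure μ]
        (ν σ : ℝ), ν ∈ Set.Ioc (0:ℝ) 1 →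
        ∀ u : ℕ → Ω → ℝ,
        (∀ j, AEStronglyMeasurable (u j) μ) →
        (∀ j, Integrable (fun ω => |u j ω| ^ 3) μ) →
        (∀ j : ℕ, 1 ≤ j → ∀ᵐ ω ∂μ, 0 ≤ u j ω) →
        -- first-moment stationarity identities (convention `u_{-1} = 0`)
        (∀ j : ℕ,
          ν * (2:ℝ) ^ (2 * j) * (∫ ω, u j ω ∂μ)
            + (2:ℝ) ^ (c * (j:ℝ)) * (∫ ω, u j ω * u (j+1) ω ∂μ)
          = if j = 0 then 0 else
              (2:ℝ) ^ (c * ((j:ℝ) - 1)) * (∫ ω, (u (j-1) ω) ^ 2 ∂μ)) →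
        -- second-moment stationarity identities
        (∀ j : ℕ,
          ν * (2:ℝ) ^ (2 * j) * (∫ ω, (u j ω) ^ 2 ∂μ)
            + (2:ℝ) ^ (c * (j:ℝ)) * (∫ ω, (u j ω) ^ 2 * u (j+1) ω ∂μ)
          = (if j = 0 then 0 else
              (2:ℝ) ^ (c * ((j:ℝ) - 1)) * (∫ ω, (u (j-1) ω) ^ 2 * u j ω ∂μ))
            + (if j = 0 then σ ^ 2 / 2 else 0)) →
        ∀ j : ℕ, (2:ℝ) ^ ((c-1) * (j:ℝ)) * (∫ ω, (u j ω) ^ 2 ∂μ)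
          ≤ C * (Real.sqrt ν * |σ| + |σ| ^ ((4:ℝ)/3)) := by
  obtain ⟨hc1, hc3⟩ := hc
  refine ⟨2, by norm_num, ?_⟩
  intro Ω _ μ _ ν σ hν u hm h3 hpos hF hS
  obtain ⟨hν0, hν1⟩ := hν
  have hq0 : ∀ j, 0 ≤ ∫ ω, (u j ω) ^ 2 * u (j+1) ω ∂μ := fun j =>
    integral_nonneg_of_ae ((hpos (j+1) (by omega)).mono fun ω h => mul_nonneg (sq_nonneg _) h)
  have hb0 : ∀ j, 0 ≤ ∫ ω, (u j ω) ^ 2 ∂μ := fun j => integral_nonneg fun ω => sq_nonneg _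
  have hE : ∀ j : ℕ, ν * (2:ℝ) ^ (2 * j) * (∫ ω, (u j ω) ^ 2 ∂μ)
            + (2:ℝ) ^ (c * (j:ℝ)) * (∫ ω, (u j ω) ^ 2 * u (j+1) ω ∂μ) ≤ σ ^ 2 / 2 := by
    intro j
    induction j with
    | zero => rw [hS 0]; simp
    | succ n ih =>
      rw [hS (n+1)]
      have : (0:ℝ) ≤ ν * (2:ℝ) ^ (2 * n) * (∫ ω, (u n ω) ^ 2 ∂μ) :=
        mul_nonneg (by positivity) (hb0 n)
      simp only [Nat.add_eq_zero_iff, one_ne_zero, and_false, if_false, Nat.add_sub_cancel,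
        add_zero, Nat.cast_add, Nat.cast_one, add_sub_cancel_right]
      linarith
  have hEb : ∀ j : ℕ, ν * (2:ℝ) ^ (2 * j) * (∫ ω, (u j ω) ^ 2 ∂μ) ≤ σ ^ 2 / 2 := fun j => by
    have := mul_nonneg (by positivity : (0:ℝ) ≤ (2:ℝ) ^ (c * (j:ℝ))) (hq0 j)
    linarith [hE j]
  have hEq : ∀ j : ℕ, (2:ℝ) ^ (c * (j:ℝ)) * (∫ ω, (u j ω) ^ 2 * u (j+1) ω ∂μ) ≤ σ ^ 2 / 2 :=
    fun j => by
    have := mul_nonneg (by positivity : (0:ℝ) ≤ ν * (2:ℝ) ^ (2 * j)) (hb0 j)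
    linarith [hE j]
  have hXT : ∀ j : ℕ, (2:ℝ) ^ (c * (j:ℝ)) ≤ ((2:ℝ) ^ j) ^ 3 := fun j => by
    rw [← pow_mul, ← Real.rpow_natCast]
    apply Real.rpow_le_rpow_of_exponent_le (by norm_num)
    push_cast
    nlinarith [Nat.cast_nonneg (α := ℝ) j]
  have hsplit : ∀ j : ℕ, (2:ℝ) ^ ((c-1) * (j:ℝ)) = (2:ℝ) ^ (c * (j:ℝ)) / 2 ^ j := fun j => by
    rw [sub_mul, one_mul, Real.rpow_sub (by norm_num), Real.rpow_natCast]
  have hXs : ∀ j : ℕ, (2:ℝ) ^ (c * ((j + 1 : ℕ):ℝ)) = (2:ℝ) ^ c * (2:ℝ) ^ (c * (j:ℝ)) := fun j => by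
    rw [← Real.rpow_add (by norm_num)]; congr 1; push_cast; ring
  have hw : (|σ| ^ ((4:ℝ)/3)) ^ 3 = |σ| ^ 4 := by
    rw [← Real.rpow_natCast, ← Real.rpow_mul (abs_nonneg _), ← Real.rpow_natCast]
    norm_num
  intro j
  have := aux_iter (fun j : ℕ => (2:ℝ) ^ ((c-1) * (j:ℝ)) * (∫ ω, (u j ω) ^ 2 ∂μ))
    (3 / 2 * (Real.sqrt ν * |σ|) + 3 / 4 * |σ| ^ ((4:ℝ)/3)) (σ ^ 2 / 2 / ν) ?_ ?_ j
  · have h1 : 0 ≤ |σ| ^ ((4:ℝ)/3) := by positivity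
    linarith
  · intro j
    rw [le_div_iff₀ hν0, hsplit]
    refine le_trans ?_ (hEb j)
    have : (2:ℝ) ^ (c * (j:ℝ)) / 2 ^ j ≤ 2 ^ (2 * j) := by
      rw [div_le_iff₀ (by positivity)]
      calc _ ≤ _ := hXT j
        _ = _ := by ring
    calc _ ≤ 2 ^ (2 * j) * (∫ ω, (u j ω) ^ 2 ∂μ) * ν := by
          gcongr
      _ = _ := by ring
  · intro j
    have hF1 := hF (j+1)
    have hb1 := hEb (j+1)
    have hq1 := hEq (j+1)
    have e4 : (2:ℝ) ^ (2 * (j + 1)) = 4 * (2 ^ j) ^ 2 := by ring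
    simp only [Nat.add_eq_zero_iff, one_ne_zero, and_false, if_false, Nat.add_sub_cancel] at hF1
    rw [hXs, e4, show ((j + 1 : ℕ) : ℝ) - 1 = j by push_cast; ring] at hF1
    rw [e4, ← sq_abs σ] at hb1
    rw [hXs, ← sq_abs σ] at hq1
    rw [hsplit j, hsplit (j+2), hXs (j+1), hXs j]
    have := aux_step ν |σ| (|σ| ^ ((4:ℝ)/3)) (2 ^ j) (2 ^ (c * (j:ℝ))) (2 ^ c) _ _ _ _ _ _ _
      hν0 (abs_nonneg _) (by positivity) hw (by positivity) (by positivity) (by positivity) (hXT j)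
      (hq0 (j+1)) (integral_nonneg_of_ae (hpos (j+1+1) (by omega))) (hb0 (j+1+1)) hF1 hb1 hq1
      (aux_cs2 (hm _) (hm _) (h3 _) (h3 _) (hpos _ (by omega)))
      (aux_cs1 (hm _) (h3 _)) (aux_cs1 (hm _) (h3 _))
    refine this.trans (le_of_eq ?_)
    rw [pow_add]
    ring
end

section
/- Let (Ω, 𝓕, ℙ) be a probability space, c ∈ [1,3], σ > 0, and let (u_j)_{j≥0} be real random variables with 𝔼|u_j|³ < ∞ for every j and u_j ≥ 0 almost surely for every j ≥ 1. Assume: (H1) for every j ≥ 1 and every η > 0, 2^{c(j-1)} 𝔼( u_{j-1}² / (u_j + η) ) ≤ 2^{cj} 𝔼(u_{j+1}); (H2) 2^{cj} 𝔼(u_j² u_{j+1}) ≤ σ²/2 for every j ≥ 0; (H3) sup_{j≥0} 2^{(c-1)j} 𝔼(u_j²) ≤ K < ∞. Then there is a constant C₀ depending only on c (one may take C₀ = 2^{3c/4}) such that for every j ≥ 2, 𝔼(u_{j-1}²) ≤ C₀ σ (1 + K)^{1/2} 2^{-cj/2} ( 𝔼(u_{j+1}²) )^{1/4}. -/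
open MeasureTheory

lemma aux_cs {Ω : Type} [MeasurableSpace Ω] (μ : Measure Ω) [IsProbabilityMeasure μ]
    (v w : Ω → ℝ) (hv : AEStronglyMeasurable v μ) (hw : AEStronglyMeasurable w μ)
    (hv2 : Integrable (fun ω => v ω ^ 2) μ)
    (hvw : Integrable (fun ω => v ω ^ 2 * w ω) μ)
    (hw0 : ∀ᵐ ω ∂μ, 0 ≤ w ω) (η : ℝ) (hη : 0 < η) :
    (∫ ω, v ω ^ 2 ∂μ) ^ 2 ≤ (∫ ω, v ω ^ 2 / (w ω + η) ∂μ) *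
      ((∫ ω, v ω ^ 2 * w ω ∂μ) + η * ∫ ω, v ω ^ 2 ∂μ) := by
  have hA : Integrable (fun ω => v ω ^ 2 / (w ω + η)) μ := by
    refine Integrable.mono' (hv2.const_mul (1/η)) ?_ ?_
    · exact ((hv.aemeasurable.pow_const 2).div
        (hw.aemeasurable.add_const η)).aestronglyMeasurable
    · filter_upwards [hw0] with ω h
      rw [Real.norm_of_nonneg (by positivity), one_div, mul_comm, ← div_eq_mul_inv]
      gcongr
      linarith
  have key : ∀ t : ℝ, 0 ≤ (∫ ω, v ω ^ 2 / (w ω + η) ∂μ) * (t * t) +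
      (2 * ∫ ω, v ω ^ 2 ∂μ) * t +
      ((∫ ω, v ω ^ 2 * w ω ∂μ) + η * ∫ ω, v ω ^ 2 ∂μ) := by
    intro t
    have h0 : 0 ≤ ∫ ω, ((v ω ^ 2 / (w ω + η) * (t * t) + v ω ^ 2 * (2 * t)) +
        (v ω ^ 2 * w ω + η * v ω ^ 2)) ∂μ := by
      apply integral_nonneg_of_ae
      filter_upwards [hw0] with ω h
      have hp : 0 < w ω + η := by linarith
      have : (v ω ^ 2 / (w ω + η) * (t * t) + v ω ^ 2 * (2 * t)) +
        (v ω ^ 2 * w ω + η * v ω ^ 2) = v ω ^ 2 * (t + w ω + η) ^ 2 / (w ω + η) := by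
        field_simp
        ring
      simp only [Pi.zero_apply]
      rw [this]
      positivity
    have g1 : Integrable (fun ω => v ω ^ 2 / (w ω + η) * (t * t) + v ω ^ 2 * (2 * t)) μ :=
      (hA.mul_const _).add (hv2.mul_const _)
    have g2 : Integrable (fun ω => v ω ^ 2 * w ω + η * v ω ^ 2) μ := hvw.add (hv2.const_mul _)
    rw [integral_add g1 g2,
      integral_add (hA.mul_const _) (hv2.mul_const _), integral_add hvw (hv2.const_mul _),
      integral_mul_const, integral_mul_const, integral_const_mul] at h0
    linarith
  have := discrim_le_zero key
  unfold discrim at this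
  linarith

theorem stmt7 (c : ℝ) (hc : c ∈ Set.Icc (1:ℝ) 3) :
    ∃ C₀ : ℝ, 0 < C₀ ∧
      ∀ (Ω : Type) [MeasurableSpace Ω] (μ : Measure Ω) [IsProbabilityMeasure μ]
        (σ K : ℝ), 0 < σ →
        ∀ u : ℕ → Ω → ℝ,
        (∀ j, AEStronglyMeasurable (u j) μ) →
        (∀ j, Integrable (fun ω => |u j ω| ^ 3) μ) →
        (∀ j : ℕ, 1 ≤ j → ∀ᵐ ω ∂μ, 0 ≤ u j ω) →
        -- (H1): for every `j ≥ 1` and `η > 0`,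
        -- `2^{c(j-1)} E( u_{j-1}² / (u_j + η) ) ≤ 2^{cj} E(u_{j+1})`
        (∀ j : ℕ, 1 ≤ j → ∀ η : ℝ, 0 < η →
          (2:ℝ) ^ (c * ((j:ℝ) - 1)) * (∫ ω, (u (j-1) ω) ^ 2 / (u j ω + η) ∂μ)
            ≤ (2:ℝ) ^ (c * (j:ℝ)) * (∫ ω, u (j+1) ω ∂μ)) →
        -- (H2): flux bound
        (∀ j : ℕ, (2:ℝ) ^ (c * (j:ℝ)) * (∫ ω, (u j ω) ^ 2 * u (j+1) ω ∂μ) ≤ σ ^ 2 / 2) →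
        -- (H3): base regularity bound
        (∀ j : ℕ, (2:ℝ) ^ ((c-1) * (j:ℝ)) * (∫ ω, (u j ω) ^ 2 ∂μ) ≤ K) →
        ∀ j : ℕ, 2 ≤ j →
          (∫ ω, (u (j-1) ω) ^ 2 ∂μ)
            ≤ C₀ * σ * Real.sqrt (1 + K) * (2:ℝ) ^ (-(c * (j:ℝ)) / 2)
              * (∫ ω, (u (j+1) ω) ^ 2 ∂μ) ^ ((1:ℝ)/4) := by
  refine ⟨(2:ℝ) ^ c, by positivity, ?_⟩
  intro Ω _ μ _ σ K hσ u hm h3 hpos H1 H2 H3 j hj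
  have i2 : ∀ j, Integrable (fun ω => u j ω ^ 2) μ := by
    intro j
    refine Integrable.mono' ((integrable_const (1:ℝ)).add (h3 j)) ((hm j).pow 2) ?_
    refine Filter.Eventually.of_forall fun ω => ?_
    simp only [Pi.add_apply, norm_pow, Real.norm_eq_abs]
    have := abs_nonneg (u j ω)
    nlinarith [mul_nonneg this (sq_nonneg (|u j ω| - 1)), sq_nonneg (|u j ω| - 1),
      mul_nonneg this this]
  have i1 : ∀ j, Integrable (u j) μ := by
    intro j
    refine Integrable.mono' ((integrable_const (1:ℝ)).add (i2 j)) (hm j) ?_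
    refine Filter.Eventually.of_forall fun ω => ?_
    simp only [Pi.add_apply, Real.norm_eq_abs]
    rw [← sq_abs (u j ω)]
    nlinarith [sq_nonneg (|u j ω| - 1)]
  obtain ⟨k, rfl⟩ : ∃ k, j = k + 1 := ⟨j - 1, by omega⟩
  have ivw : Integrable (fun ω => u k ω ^ 2 * u (k+1) ω) μ := by
    refine Integrable.mono' ((h3 k).add (h3 (k+1))) (((hm k).pow 2).mul (hm (k+1))) ?_
    refine Filter.Eventually.of_forall fun ω => ?_
    simp only [Pi.add_apply, norm_mul, norm_pow, Real.norm_eq_abs]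
    have ha := abs_nonneg (u k ω)
    have hb := abs_nonneg (u (k+1) ω)
    rcases le_total (|u k ω|) (|u (k+1) ω|) with h | h
    · have : |u k ω| ^ 2 * |u (k+1) ω| ≤ |u (k+1) ω| ^ 2 * |u (k+1) ω| := by gcongr
      have h' := pow_nonneg ha 3
      nlinarith
    · have : |u k ω| ^ 2 * |u (k+1) ω| ≤ |u k ω| ^ 2 * |u k ω| := by gcongr
      have h' := pow_nonneg hb 3
      nlinarith
  have hcs := aux_cs μ (u k) (u (k+1)) (hm k) (hm (k+1)) (i2 k) ivw (hpos (k+1) (by omega))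
  have h1 := H1 (k+1) (by omega)
  have h2 := H2 k
  have hK : 0 ≤ K := le_trans
    (mul_nonneg (by positivity) (integral_nonneg fun ω => sq_nonneg _)) (H3 0)
  simp only [Nat.add_sub_cancel] at h1 ⊢
  set m := ∫ ω, u k ω ^ 2 ∂μ with hmdef
  set F := ∫ ω, u k ω ^ 2 * u (k+1) ω ∂μ with hF
  set X := ∫ ω, u (k+1+1) ω ∂μ with hX
  set Y := ∫ ω, u (k+1+1) ω ^ 2 ∂μ with hY
  have m0 : 0 ≤ m := integral_nonneg fun ω => sq_nonneg _
  have Y0 : 0 ≤ Y := integral_nonneg fun ω => sq_nonneg _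
  have X0 : 0 ≤ X := integral_nonneg_of_ae (hpos (k+1+1) (by omega))
  have F0 : 0 ≤ F := integral_nonneg_of_ae (by
    filter_upwards [hpos (k+1) (by omega)] with ω h
    exact mul_nonneg (sq_nonneg _) h)
  -- Jensen
  have XY : X ^ 2 ≤ Y := by
    have h0 : 0 ≤ ∫ ω, ((u (k+1+1) ω ^ 2 - (2 * X) * u (k+1+1) ω) + X ^ 2) ∂μ := by
      refine integral_nonneg fun ω => ?_
      simp only [Pi.zero_apply]
      nlinarith [sq_nonneg (u (k+1+1) ω - X)]
    have g1 : Integrable (fun ω => u (k+1+1) ω ^ 2 - (2 * X) * u (k+1+1) ω) μ :=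
      (i2 _).sub ((i1 _).const_mul _)
    rw [integral_add g1 (integrable_const _),
      integral_sub (i2 _) ((i1 _).const_mul _), integral_const_mul, ← hX, ← hY] at h0
    simp at h0
    nlinarith
  have e1 : (2:ℝ) ^ (c * ((k+1:ℕ):ℝ)) = 2 ^ c * 2 ^ (c * (k:ℝ)) := by
    rw [← Real.rpow_add (by norm_num)]
    push_cast
    ring_nf
  have e2 : (2:ℝ) ^ (c * (((k+1:ℕ):ℝ) - 1)) = 2 ^ (c * (k:ℝ)) := by
    push_cast
    ring_nf
  have e3 : ((2:ℝ) ^ (-(c * ((k+1:ℕ):ℝ)) / 2)) ^ 2 * (2 ^ c * 2 ^ (c * (k:ℝ))) = 1 := by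
    rw [← e1, ← Real.rpow_natCast, ← Real.rpow_mul (by norm_num),
      ← Real.rpow_add (by norm_num)]
    have : -(c * ((k+1:ℕ):ℝ)) / 2 * ((2:ℕ):ℝ) + c * ((k+1:ℕ):ℝ) = 0 := by
      push_cast
      ring
    rw [this, Real.rpow_zero]
  rw [e1, e2] at h1
  set a := (2:ℝ) ^ c with ha
  set b := (2:ℝ) ^ (c * (k:ℝ)) with hb
  set d := (2:ℝ) ^ (-(c * ((k+1:ℕ):ℝ)) / 2) with hd
  have a0 : 0 < a := by positivity
  have b0 : 0 < b := by positivity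
  have d0 : 0 < d := by positivity
  have hlim : m ^ 2 ≤ a * X * F := by
    have step : ∀ η : ℝ, 0 < η → m ^ 2 ≤ a * X * F + a * X * m * η := by
      intro η hη
      have hA := h1 η hη
      have hA' : (∫ ω, u k ω ^ 2 / (u (k+1) ω + η) ∂μ) ≤ a * X := by
        refine le_of_mul_le_mul_left ?_ b0
        linarith
      have := mul_le_mul_of_nonneg_right hA' (by positivity : 0 ≤ F + η * m)
      have := hcs η hη
      linarith
    have hq : 0 ≤ a * X * m := by positivity
    refine le_of_forall_pos_le_add fun ε hε => ?_
    have := step (ε / (a * X * m + 1)) (by positivity)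
    have h' : a * X * m * (ε / (a * X * m + 1)) ≤ ε := by
      rw [mul_div_assoc', div_le_iff₀ (by positivity)]
      nlinarith
    linarith
  set r := Y ^ ((1:ℝ)/4) with hr
  have r0 : 0 ≤ r := by positivity
  have r4 : r ^ 4 = Y := by
    rw [hr, ← Real.rpow_natCast, ← Real.rpow_mul Y0]
    norm_num
  have Xr : X ≤ r ^ 2 := by
    refine (pow_le_pow_iff_left₀ (by positivity) (by positivity) two_ne_zero).1 ?_
    nlinarith
  have s1 : 1 ≤ Real.sqrt (1 + K) := by
    rw [Real.one_le_sqrt]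
    linarith
  have hmain : m ≤ a * σ * d * r := by
    refine (pow_le_pow_iff_left₀ (by positivity) (by positivity) two_ne_zero).1 ?_
    have hF' : F ≤ a * d ^ 2 * σ ^ 2 := by
      have : F = a * d ^ 2 * (b * F) := by linear_combination (-F) * e3
      rw [this]
      gcongr
      nlinarith [sq_nonneg σ]
    calc m ^ 2 ≤ a * X * F := hlim
      _ ≤ a * r ^ 2 * (a * d ^ 2 * σ ^ 2) := by gcongr
      _ = (a * σ * d * r) ^ 2 := by ring
  calc m ≤ a * σ * d * r := hmain
    _ = a * σ * 1 * d * r := by ring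
    _ ≤ a * σ * Real.sqrt (1 + K) * d * r := by gcongr
end

section
/- Let (Ω, 𝓕, ℙ) be a probability space, c > 0, b ≥ 0, D ≥ 0, and let (u_j)_{j≥0} be real random variables with 𝔼(u_j²) < ∞ for every j. Suppose sup_{j≥0} 2^{bj} 𝔼(u_j²) ≤ C_b < ∞ and, for every j ≥ 2, 𝔼(u_{j-1}²) ≤ D 2^{-cj/2} ( 𝔼(u_{j+1}²) )^{1/4}. Then for every a with 0 ≤ a ≤ c/2 + b/4 one has sup_{j≥0} 2^{aj} 𝔼(u_j²) ≤ max( C_b, D C_b^{1/4} ). -/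
open MeasureTheory

theorem stmt8 {Ω : Type*} [MeasurableSpace Ω] (μ : Measure Ω) [IsProbabilityMeasure μ]
    (c b D Cb : ℝ) (hc : 0 < c) (hb : 0 ≤ b) (hD : 0 ≤ D)
    (u : ℕ → Ω → ℝ)
    (hint : ∀ j, Integrable (fun ω => (u j ω) ^ 2) μ)
    (hsup : ∀ j : ℕ, (2:ℝ) ^ (b * (j:ℝ)) * (∫ ω, (u j ω) ^ 2 ∂μ) ≤ Cb)
    (hrec : ∀ j : ℕ, 2 ≤ j →
      (∫ ω, (u (j-1) ω) ^ 2 ∂μ)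
        ≤ D * (2:ℝ) ^ (-(c * (j:ℝ)) / 2) * (∫ ω, (u (j+1) ω) ^ 2 ∂μ) ^ ((1:ℝ)/4)) :
    ∀ a : ℝ, 0 ≤ a → a ≤ c/2 + b/4 →
      ∀ j : ℕ, (2:ℝ) ^ (a * (j:ℝ)) * (∫ ω, (u j ω) ^ 2 ∂μ)
        ≤ max Cb (D * Cb ^ ((1:ℝ)/4)) := by
  intro a ha hac j
  have hE : ∀ k, 0 ≤ ∫ ω, (u k ω) ^ 2 ∂μ := fun k => integral_nonneg fun ω => sq_nonneg _
  have h2 : (0:ℝ) < 2 := two_pos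
  have hCb : 0 ≤ Cb := le_trans (mul_nonneg (Real.rpow_nonneg h2.le _) (hE 0)) (hsup 0)
  rcases Nat.eq_zero_or_pos j with hj | hj
  · subst hj
    refine le_trans ?_ (le_max_left _ _)
    have h := hsup 0
    simpa using h
  · refine le_trans ?_ (le_max_right _ _)
    have h1 := hrec (j+1) (by omega)
    rw [Nat.add_sub_cancel] at h1
    have h3 : (∫ ω, (u (j+1+1) ω) ^ 2 ∂μ) ≤ Cb * (2:ℝ) ^ (-(b * ((j+1+1 : ℕ):ℝ))) := by
      rw [Real.rpow_neg h2.le, ← div_eq_mul_inv, le_div_iff₀ (Real.rpow_pos_of_pos h2 _), mul_comm]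
      exact hsup (j+1+1)
    have h4 := Real.rpow_le_rpow (hE _) h3 (by norm_num : (0:ℝ) ≤ 1/4)
    rw [Real.mul_rpow hCb (Real.rpow_nonneg h2.le _), ← Real.rpow_mul h2.le] at h4
    have hj0 : (0:ℝ) ≤ j := Nat.cast_nonneg j
    have hC4 : 0 ≤ Cb ^ ((1:ℝ)/4) := Real.rpow_nonneg hCb _
    calc (2:ℝ) ^ (a * (j:ℝ)) * (∫ ω, (u j ω) ^ 2 ∂μ)
        ≤ (2:ℝ) ^ (a * (j:ℝ)) * (D * (2:ℝ) ^ (-(c * ((j+1 : ℕ):ℝ)) / 2) *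
            (Cb ^ ((1:ℝ)/4) * (2:ℝ) ^ (-(b * ((j+1+1 : ℕ):ℝ)) * (1/4)))) := by
          refine mul_le_mul_of_nonneg_left (h1.trans ?_) (Real.rpow_nonneg h2.le _)
          exact mul_le_mul_of_nonneg_left h4 (mul_nonneg hD (Real.rpow_nonneg h2.le _))
      _ = D * Cb ^ ((1:ℝ)/4) * (2:ℝ) ^ (a * (j:ℝ) + -(c * ((j+1 : ℕ):ℝ)) / 2
            + -(b * ((j+1+1 : ℕ):ℝ)) * (1/4)) := by
          rw [Real.rpow_add h2, Real.rpow_add h2]; ring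
      _ ≤ D * Cb ^ ((1:ℝ)/4) * 1 := by
          refine mul_le_mul_of_nonneg_left ?_ (mul_nonneg hD hC4)
          refine Real.rpow_le_one_of_one_le_of_nonpos one_le_two ?_
          push_cast
          nlinarith [mul_le_mul_of_nonneg_right hac hj0]
      _ = _ := mul_one _
end

section
/- Let (Ω, 𝓕, ℙ) be a probability space, c ∈ [1,3], D ≥ 0, and let (u_j)_{j≥0} be real random variables with 𝔼(u_j²) < ∞ for every j. Suppose sup_{j≥0} 2^{(c-1)j} 𝔼(u_j²) ≤ K < ∞ and, for every j ≥ 2, 𝔼(u_{j-1}²) ≤ D 2^{-cj/2} ( 𝔼(u_{j+1}²) )^{1/4}. Then sup_{j≥0} 2^{2cj/3} 𝔼(u_j²) ≤ max( K, D^{4/3} ). -/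
open MeasureTheory

lemma aux_bootstrap (c D M : ℝ) (hc1 : 1 ≤ c) (hD : 0 ≤ D) (hM : 0 ≤ M)
    (hDM : D ≤ M ^ ((3:ℝ)/4)) (e : ℕ → ℝ) (he : ∀ j, 0 ≤ e j)
    (hsup : ∀ j : ℕ, (2:ℝ) ^ ((c-1) * (j:ℝ)) * e j ≤ M)
    (hrec : ∀ i : ℕ, 1 ≤ i →
      e i ≤ D * (2:ℝ) ^ (-(c * ((i:ℝ)+1)) / 2) * (e (i+2)) ^ ((1:ℝ)/4)) (hc3 : c ≤ 3)
    (k : ℕ) : ∀ i : ℕ, 1 ≤ i →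
      e i ≤ M * (2:ℝ) ^ (((3-c)/3 * (1/4)^k - 2*c/3) * (i:ℝ)) := by
  induction k with
  | zero =>
    intro i _
    have h := hsup i
    have h2 : (0:ℝ) < (2:ℝ) ^ ((c-1) * (i:ℝ)) := by positivity
    have h3 : ((3-c)/3 * (1/4)^0 - 2*c/3) * (i:ℝ) = -((c-1) * (i:ℝ)) := by ring
    rw [h3, Real.rpow_neg (by norm_num), ← div_eq_mul_inv, le_div_iff₀ h2]
    linarith
  | succ k ih =>
    intro i hi
    have h := ih (i+2) (by omega)
    set b : ℝ := (3-c)/3 * (1/4)^k with hb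
    have hb1 : b ≤ 2/3 := by
      have : ((1:ℝ)/4)^k ≤ 1 := pow_le_one₀ (by norm_num) (by norm_num)
      have h0 : 0 ≤ ((1:ℝ)/4)^k := by positivity
      rw [hb]; nlinarith
    have h4 : (e (i+2)) ^ ((1:ℝ)/4) ≤
        M ^ ((1:ℝ)/4) * (2:ℝ) ^ ((b - 2*c/3) * ((i:ℝ)+2) * (1/4)) := by
      refine (Real.rpow_le_rpow (he _) h (by norm_num)).trans_eq ?_
      rw [Real.mul_rpow hM (by positivity), ← Real.rpow_mul (by norm_num)]
      push_cast
      rfl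
    have hMM : M ^ ((3:ℝ)/4) * M ^ ((1:ℝ)/4) = M := by
      rw [← Real.rpow_add_of_nonneg hM (by norm_num) (by norm_num)]
      norm_num
    calc e i ≤ D * (2:ℝ) ^ (-(c * ((i:ℝ)+1)) / 2) * (e (i+2)) ^ ((1:ℝ)/4) := hrec i hi
      _ ≤ M ^ ((3:ℝ)/4) * (2:ℝ) ^ (-(c * ((i:ℝ)+1)) / 2) *
          (M ^ ((1:ℝ)/4) * (2:ℝ) ^ ((b - 2*c/3) * ((i:ℝ)+2) * (1/4))) := by
        have := Real.rpow_nonneg (he (i+2)) ((1:ℝ)/4)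
        gcongr
      _ = M * (2:ℝ) ^ (-(c * ((i:ℝ)+1)) / 2 + (b - 2*c/3) * ((i:ℝ)+2) * (1/4)) := by
        rw [Real.rpow_add (by norm_num)]
        nth_rewrite 3 [← hMM]
        ring
      _ ≤ _ := by
        have h5 : (3-c)/3 * (1/4)^(k+1) = b / 4 := by rw [hb, pow_succ]; ring
        rw [h5]
        refine mul_le_mul_of_nonneg_left ?_ hM
        refine Real.rpow_le_rpow_of_exponent_le (by norm_num) ?_
        nlinarith

theorem stmt9 {Ω : Type*} [MeasurableSpace Ω] (μ : Measure Ω) [IsProbabilityMeasure μ]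
    (c D K : ℝ) (hc : c ∈ Set.Icc (1:ℝ) 3) (hD : 0 ≤ D)
    (u : ℕ → Ω → ℝ)
    (hint : ∀ j, Integrable (fun ω => (u j ω) ^ 2) μ)
    (hsup : ∀ j : ℕ, (2:ℝ) ^ ((c-1) * (j:ℝ)) * (∫ ω, (u j ω) ^ 2 ∂μ) ≤ K)
    (hrec : ∀ j : ℕ, 2 ≤ j →
      (∫ ω, (u (j-1) ω) ^ 2 ∂μ)
        ≤ D * (2:ℝ) ^ (-(c * (j:ℝ)) / 2) * (∫ ω, (u (j+1) ω) ^ 2 ∂μ) ^ ((1:ℝ)/4)) :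
    ∀ j : ℕ, (2:ℝ) ^ (2 * c * (j:ℝ) / 3) * (∫ ω, (u j ω) ^ 2 ∂μ)
      ≤ max K (D ^ ((4:ℝ)/3)) := by
  have he : ∀ j, 0 ≤ ∫ ω, (u j ω) ^ 2 ∂μ := fun j => integral_nonneg fun ω => sq_nonneg _
  have hK : 0 ≤ K := le_trans (mul_nonneg (by positivity) (he 0)) (hsup 0)
  set M := max K (D ^ ((4:ℝ)/3)) with hMdef
  have hM : 0 ≤ M := hK.trans (le_max_left _ _)
  have hDM : D ≤ M ^ ((3:ℝ)/4) := by
    have h1 : (D ^ ((4:ℝ)/3)) ^ ((3:ℝ)/4) ≤ M ^ ((3:ℝ)/4) :=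
      Real.rpow_le_rpow (by positivity) (le_max_right _ _) (by norm_num)
    rw [← Real.rpow_mul hD] at h1
    norm_num at h1
    exact h1
  intro j
  rcases Nat.eq_zero_or_pos j with rfl | hj
  · have h0 := hsup 0
    have h1 : K ≤ M := le_max_left _ _
    simp only [Nat.cast_zero, mul_zero, zero_div, Real.rpow_zero, one_mul] at h0 ⊢
    exact h0.trans h1
  have key := fun k => aux_bootstrap c D M hc.1 hD hM hDM (fun j => ∫ ω, (u j ω) ^ 2 ∂μ) he
    (fun j => (hsup j).trans (le_max_left _ _))
    (fun i hi => by
      have := hrec (i+1) (by omega)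
      push_cast at this
      exact this) hc.2 k j hj
  have hlim : Filter.Tendsto
      (fun k : ℕ => M * (2:ℝ) ^ (((3-c)/3 * (1/4)^k - 2*c/3) * (j:ℝ))) Filter.atTop
      (nhds (M * (2:ℝ) ^ (((3-c)/3 * 0 - 2*c/3) * (j:ℝ)))) := by
    have h0 : Filter.Tendsto (fun k : ℕ => ((1:ℝ)/4)^k) Filter.atTop (nhds 0) :=
      tendsto_pow_atTop_nhds_zero_of_lt_one (by norm_num) (by norm_num)
    refine Filter.Tendsto.const_mul _ ?_
    refine Filter.Tendsto.rpow tendsto_const_nhds ?_ (Or.inl (by norm_num))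
    exact ((h0.const_mul _).sub_const _).mul_const _
  have h := ge_of_tendsto' hlim key
  have h2 : (0:ℝ) < (2:ℝ) ^ (2 * c * (j:ℝ) / 3) := by positivity
  have h3 : ((3-c)/3 * 0 - 2*c/3) * (j:ℝ) = -(2 * c * (j:ℝ) / 3) := by ring
  rw [h3, Real.rpow_neg (by norm_num), ← div_eq_mul_inv, le_div_iff₀ h2] at h
  linarith
end

section
/- Let c ∈ [1,3]. For every m ≥ 0 and every multilinear map S̃ ∈ 𝒮_m, there exists a nonzero constant C (depending on S̃) such that S̃(e₀, …, e₀) = C e_{m+1}. -/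
/-- Sequences indexed by `ℕ`. -/
abbrev ShellSeq : Type := ℕ → ℝ

/-- The linear operator `(Au)_j = 2^{2j} u_j`. -/
noncomputable def Aop : ShellSeq → ShellSeq := fun u j => (2:ℝ) ^ (2 * j) * u j

/-- The symmetrized shell-model bilinear map
`B(u,v)_j = 2^{cj-1}( u_{j+1} v_j + v_{j+1} u_j ) - 2^{c(j-1)} u_{j-1} v_{j-1}`
with the convention that entries at index `-1` vanish. -/
noncomputable def Bsym (c : ℝ) (u v : ShellSeq) : ShellSeq := fun j =>
  (2:ℝ) ^ (c * (j:ℝ) - 1) * (u (j+1) * v j + v (j+1) * u j)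
    - (if j = 0 then 0 else (2:ℝ) ^ (c * ((j:ℝ) - 1)) * u (j-1) * v (j-1))

/-- The standard basis sequence `e_k`. -/
noncomputable def eSeq (k : ℕ) : ShellSeq := fun j => if j = k then 1 else 0

/-- The families `𝓜_k` of `k`-linear maps (a `k`-linear map is represented as a function of an
infinite list of arguments, reading only the first `k` of them):
`𝓜₁ = { u ↦ Aⁿu }`, `𝓜₂ = { (u,v) ↦ Aʲ B(Aˡ u, Aᵐ v) }`, and for `k ≥ 3`, `𝓜_k` is built from
`E ∈ 𝓜_{k-1}` and `B̃ ∈ 𝓜₂` as `B̃(E(u₁,…,u_{k-1}), u_k)`, or `B̃(u₁, E(u₂,…,u_k))`, or by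
substituting `B̃(u_i, u_{i+1})` into one argument slot of `E`. -/
noncomputable def Mfam (c : ℝ) : ℕ → Set ((ℕ → ShellSeq) → ShellSeq)
  | 0 => ∅
  | 1 => { F | ∃ n : ℕ, F = fun a => Aop^[n] (a 0) }
  | 2 => { F | ∃ j l m : ℕ,
      F = fun a => Aop^[j] (Bsym c (Aop^[l] (a 0)) (Aop^[m] (a 1))) }
  | (k+3) => { F | ∃ E ∈ Mfam c (k+2), ∃ j l m : ℕ,
      (F = fun a => Aop^[j] (Bsym c (Aop^[l] (E a)) (Aop^[m] (a (k+2))))) ∨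
      (F = fun a => Aop^[j] (Bsym c (Aop^[l] (a 0)) (Aop^[m] (E fun p => a (p+1))))) ∨
      (∃ i : ℕ, i < k + 2 ∧
        F = fun a => E fun p =>
          if p < i then a p
          else if p = i then Aop^[j] (Bsym c (Aop^[l] (a i)) (Aop^[m] (a (i+1))))
          else a (p+1)) }

/-- The families `𝒮_m`: `𝒮₀ = 𝓜₂` and `𝒮_m` consists of the maps
`(u₁,…,u_{2^{m+1}}) ↦ S̃(B̃¹(u₁,u₂), …, B̃^{2^m}(u_{2^{m+1}-1}, u_{2^{m+1}}))` with
`S̃ ∈ 𝒮_{m-1}` and `B̃ⁱ ∈ 𝓜₂`. -/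
noncomputable def Sfam (c : ℝ) : ℕ → Set ((ℕ → ShellSeq) → ShellSeq)
  | 0 => Mfam c 2
  | (m+1) => { F | ∃ S ∈ Sfam c m, ∃ Bs : ℕ → ((ℕ → ShellSeq) → ShellSeq),
      (∀ i, Bs i ∈ Mfam c 2) ∧
      F = fun a => S fun i => Bs i fun p => a (2*i + p) }

lemma aux_A (n k : ℕ) (C : ℝ) :
    Aop^[n] (C • eSeq k) = (((2:ℝ) ^ (2 * k)) ^ n * C) • eSeq k := by
  induction n generalizing C with
  | zero => simp
  | succ n ih =>
    have h : Aop (C • eSeq k) = ((2:ℝ) ^ (2 * k) * C) • eSeq k := by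
      funext j
      by_cases hj : j = k
      · subst hj; simp [Aop, eSeq]
      · simp [Aop, eSeq, hj]
    rw [Function.iterate_succ_apply, h, ih]
    congr 1
    ring

lemma aux_B (c : ℝ) (k : ℕ) (C D : ℝ) :
    Bsym c (C • eSeq k) (D • eSeq k) = (-((2:ℝ) ^ (c * (k:ℝ)) * C * D)) • eSeq (k+1) := by
  funext j
  have h1 : ∀ x y : ℝ, x * (if j + 1 = k then 1 else 0) * (y * (if j = k then 1 else 0)) = 0 := by
    intro x y
    by_cases h : j = k
    · have : ¬ (j + 1 = k) := by omega
      simp [this]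
    · simp [h]
  simp only [Bsym, eSeq, Pi.smul_apply, smul_eq_mul, h1]
  cases j with
  | zero => simp
  | succ j =>
    by_cases h : j = k
    · subst h; simp
    · simp [h]

lemma aux_M (c : ℝ) (F : (ℕ → ShellSeq) → ShellSeq) (hF : F ∈ Mfam c 2) (k : ℕ)
    (C : ℕ → ℝ) (hC : ∀ i, C i ≠ 0) :
    ∃ D : ℝ, D ≠ 0 ∧ F (fun i => C i • eSeq k) = D • eSeq (k+1) := by
  simp only [Mfam, Set.mem_setOf_eq] at hF
  obtain ⟨j, l, m, rfl⟩ := hF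
  simp only [aux_A, aux_B]
  refine ⟨_, ?_, rfl⟩
  have h0 := hC 0
  have h1 := hC 1
  have h2 : (2:ℝ) ^ (c * (k:ℝ)) ≠ 0 := (Real.rpow_pos_of_pos two_pos _).ne'
  simp [h0, h1, h2]

lemma aux_S (c : ℝ) (m : ℕ) : ∀ (S : (ℕ → ShellSeq) → ShellSeq) (_ : S ∈ Sfam c m) (k : ℕ)
    (C : ℕ → ℝ) (_ : ∀ i, C i ≠ 0),
    ∃ D : ℝ, D ≠ 0 ∧ S (fun i => C i • eSeq k) = D • eSeq (k+m+1) := by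
  induction m with
  | zero =>
    intro S hS k C hC
    simp only [Sfam] at hS
    exact aux_M c S hS k C hC
  | succ m ih =>
    intro S hS k C hC
    simp only [Sfam, Set.mem_setOf_eq] at hS
    obtain ⟨T, hT, Bs, hBs, rfl⟩ := hS
    choose D hD hDe using fun i => aux_M c (Bs i) (hBs i) k (fun p => C (2*i+p)) (fun p => hC _)
    obtain ⟨E, hE, hEe⟩ := ih T hT (k+1) D hD
    refine ⟨E, hE, ?_⟩
    simp only [hDe, hEe]
    congr 2
    omega

theorem stmt11 (c : ℝ) (hc : c ∈ Set.Icc (1:ℝ) 3) (m : ℕ)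
    (S : (ℕ → ShellSeq) → ShellSeq) (hS : S ∈ Sfam c m) :
    ∃ C : ℝ, C ≠ 0 ∧ S (fun _ => eSeq 0) = C • eSeq (m+1) := by
  have h := aux_S c m S hS 0 (fun _ => 1) (fun _ => one_ne_zero)
  simpa using h
end

section
/- Let c ∈ [1,3]. For every k ≥ 2 and every E ∈ 𝓜_k, the vector E(e₀, …, e₀) is a scalar multiple of a single standard basis vector e_l. If moreover E does not belong to 𝒮_m for any m ≥ 0, then E(e₀, …, e₀) = C e_l for some index l ≤ ⌈log₂ k⌉ and some constant C (which may be zero). -/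
/-- `u` is a multiple of a basis vector whose index `l` satisfies `2^l ≤ w`. -/
def PW (u : ShellSeq) (w : ℕ) : Prop := ∃ l : ℕ, ∃ C : ℝ, 2 ^ l ≤ w ∧ u = C • eSeq l

lemma PW_Aop {u : ShellSeq} {w : ℕ} (h : PW u w) : PW (Aop u) w := by
  obtain ⟨l, C, hl, rfl⟩ := h
  refine ⟨l, (2:ℝ) ^ (2 * l) * C, hl, ?_⟩
  funext j
  by_cases hj : j = l
  · subst hj; simp [Aop, eSeq]
  · simp [Aop, eSeq, hj]

lemma PW_Aop_iter {u : ShellSeq} {w : ℕ} (n : ℕ) (h : PW u w) : PW (Aop^[n] u) w := by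
  induction n generalizing u with
  | zero => simpa using h
  | succ n ih => rw [Function.iterate_succ_apply]; exact ih (PW_Aop h)

lemma Bsym_comm' (c : ℝ) (u v : ShellSeq) : Bsym c u v = Bsym c v u := by
  funext j
  simp only [Bsym]
  split_ifs <;> ring

lemma Bsym_step (c C D : ℝ) (i : ℕ) :
    Bsym c (C • eSeq i) (D • eSeq (i + 1)) = ((2:ℝ) ^ (c * (i:ℝ) - 1) * (C * D)) • eSeq i := by
  funext j
  simp only [Bsym, eSeq, Pi.smul_apply, smul_eq_mul]
  by_cases hj : j = i
  · subst hj
    have h1 : j - 1 ≠ j + 1 := by omega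
    simp [h1]
    left; ring
  · have h2 : ¬ (j - 1 = i ∧ j - 1 = i + 1) := by omega
    have h3 : ¬ (j + 1 = i ∧ j = i + 1) := by omega
    by_cases h4 : j + 1 = i <;> by_cases h5 : j - 1 = i <;> simp_all

lemma Bsym_same (c C D : ℝ) (i : ℕ) :
    Bsym c (C • eSeq i) (D • eSeq i) = (-((2:ℝ) ^ (c * (i:ℝ)) * (C * D))) • eSeq (i + 1) := by
  funext j
  simp only [Bsym, eSeq, Pi.smul_apply, smul_eq_mul]
  have h3 : ¬ (j + 1 = i ∧ j = i) := by omega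
  rcases j with _ | j
  · by_cases h4 : 0 = i <;> by_cases h5 : 0 + 1 = i <;> simp_all <;> (intros; omega)
  · by_cases hj : j = i
    · subst hj
      simp; ring
    · by_cases h4 : j + 1 + 1 = i <;> by_cases h5 : j + 1 = i <;> simp_all <;> (intros; omega)

lemma Bsym_far (c C D : ℝ) (i k : ℕ) (h1 : i ≠ k) (h2 : k ≠ i + 1) (h3 : i ≠ k + 1) :
    Bsym c (C • eSeq i) (D • eSeq k) = 0 := by
  funext j
  simp only [Bsym, eSeq, Pi.smul_apply, smul_eq_mul, Pi.zero_apply]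
  have a1 : ¬ (j + 1 = i ∧ j = k) := by omega
  have a2 : ¬ (j + 1 = k ∧ j = i) := by omega
  have a3 : ¬ (j - 1 = i ∧ j - 1 = k) := by omega
  have b1 : (C * if j + 1 = i then 1 else 0) * (D * if j = k then 1 else 0) = 0 := by
    split_ifs <;> simp_all
  have b2 : (D * if j + 1 = k then 1 else 0) * (C * if j = i then 1 else 0) = 0 := by
    split_ifs <;> simp_all
  have b3 : (C * if j - 1 = i then 1 else 0) * (D * if j - 1 = k then 1 else 0) = 0 := by
    split_ifs <;> simp_all
  rw [b1, b2, mul_assoc, b3]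
  simp

lemma PW_Bsym (c : ℝ) {u v : ShellSeq} {w w' : ℕ} (hu : PW u w) (hv : PW v w') :
    PW (Bsym c u v) (w + w') := by
  obtain ⟨i, C, hi, rfl⟩ := hu
  obtain ⟨k, D, hk, rfl⟩ := hv
  by_cases h1 : i = k
  · subst h1
    exact ⟨i + 1, _, by rw [pow_succ]; omega, Bsym_same c C D i⟩
  by_cases h2 : k = i + 1
  · subst h2
    exact ⟨i, _, by omega, Bsym_step c C D i⟩
  by_cases h3 : i = k + 1
  · subst h3
    exact ⟨k, _, by omega, by rw [Bsym_comm']; exact Bsym_step c D C k⟩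
  · refine ⟨i, 0, by omega, ?_⟩
    rw [Bsym_far c C D i k h1 h2 h3]; simp

lemma PW_M2 (c : ℝ) {u v : ShellSeq} {w w' : ℕ} (j l m : ℕ) (hu : PW u w) (hv : PW v w') :
    PW (Aop^[j] (Bsym c (Aop^[l] u) (Aop^[m] v))) (w + w') :=
  PW_Aop_iter j (PW_Bsym c (PW_Aop_iter l hu) (PW_Aop_iter m hv))

lemma sum_merge (w : ℕ → ℕ) (i n : ℕ) :
    ∑ p ∈ Finset.range n, (if p < i then w p else if p = i then w i + w (i + 1) else w (p + 1))
      = ∑ p ∈ Finset.range (if i < n then n + 1 else n), w p := by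
  induction n with
  | zero => simp
  | succ n ih =>
    rw [Finset.sum_range_succ, ih]
    rcases lt_trichotomy n i with h | h | h
    · have h1 : ¬ i < n := by omega
      have h2 : ¬ i < n + 1 := by omega
      simp [h, h1, h2, Finset.sum_range_succ]
    · subst h
      simp [Finset.sum_range_succ, add_assoc]
    · have h1 : ¬ n < i := by omega
      have h2 : i < n + 1 := by omega
      have h3 : n ≠ i := by omega
      simp [h, h1, h2, h3, Finset.sum_range_succ]

lemma PW_Mfam (c : ℝ) (k : ℕ) : ∀ E ∈ Mfam c (k + 2), ∀ (a : ℕ → ShellSeq) (w : ℕ → ℕ),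
    (∀ p, PW (a p) (w p)) → PW (E a) (∑ p ∈ Finset.range (k + 2), w p) := by
  induction k with
  | zero =>
    rintro E ⟨j, l, m, rfl⟩ a w h
    simpa [Finset.sum_range_succ] using PW_M2 c j l m (h 0) (h 1)
  | succ k ih =>
    rintro F ⟨E, hE, j, l, m, rfl | rfl | ⟨i, hi, rfl⟩⟩ a w h
    · rw [Finset.sum_range_succ]
      exact PW_M2 c j l m (ih E hE a w h) (h _)
    · rw [Finset.sum_range_succ', add_comm]
      exact PW_M2 c j l m (h 0) (ih E hE (fun p => a (p + 1)) (fun p => w (p + 1)) fun p => h _)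
    · have := sum_merge w i (k + 2)
      rw [if_pos hi] at this
      rw [show k + 1 + 2 = k + 2 + 1 by ring, ← this]
      apply ih E hE
      intro p
      by_cases h1 : p < i
      · simpa [h1] using h p
      by_cases h2 : p = i
      · subst h2
        simpa using PW_M2 c j l m (h p) (h (p + 1))
      · simpa [h1, h2] using h (p + 1)

theorem stmt12 (c : ℝ) (hc : c ∈ Set.Icc (1:ℝ) 3) (k : ℕ) (hk : 2 ≤ k)
    (E : (ℕ → ShellSeq) → ShellSeq) (hE : E ∈ Mfam c k) :
    (∃ l : ℕ, ∃ C : ℝ, E (fun _ => eSeq 0) = C • eSeq l) ∧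
    ((∀ m : ℕ, E ∉ Sfam c m) →
      ∃ l : ℕ, ∃ C : ℝ, l ≤ Nat.clog 2 k ∧ E (fun _ => eSeq 0) = C • eSeq l) := by
  obtain ⟨n, rfl⟩ : ∃ n, k = n + 2 := ⟨k - 2, by omega⟩
  obtain ⟨l, C, hl, hC⟩ := PW_Mfam c n E hE (fun _ => eSeq 0) (fun _ => 1)
    (fun _ => ⟨0, 1, by simp, by simp⟩)
  refine ⟨⟨l, C, hC⟩, fun _ => ⟨l, C, ?_, hC⟩⟩
  have h1 : 2 ^ l ≤ n + 2 := by simpa using hl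
  have h2 : 2 ^ l ≤ 2 ^ Nat.clog 2 (n + 2) := h1.trans (Nat.le_pow_clog (by norm_num) _)
  exact (Nat.pow_le_pow_iff_right (by norm_num)).1 h2
end

section
/- Let ν ≥ 0, c ∈ ℝ, T > 0, and let u_j : [0,T] → ℝ for j ≥ 0 be functions such that u₀ is continuous and, for each j ≥ 1, u_j is differentiable on [0,T] and satisfies u_j′(t) = -ν 2^{2j} u_j(t) - 2^{cj} u_j(t) u_{j+1}(t) + 2^{c(j-1)} u_{j-1}(t)² for all t ∈ [0,T], with all u_j continuous. If u_j(0) ≥ 0 for every j ≥ 1, then u_j(t) ≥ 0 for every j ≥ 1 and every t ∈ [0,T]. -/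
theorem linear_ode_nonneg (T : ℝ) (hT : 0 < T) (f a b : ℝ → ℝ)
    (ha : ContinuousOn a (Set.Icc 0 T))
    (hb : ∀ t ∈ Set.Icc (0:ℝ) T, 0 ≤ b t)
    (hf : ∀ t ∈ Set.Icc (0:ℝ) T, HasDerivWithinAt f (-(a t * f t) + b t) (Set.Icc 0 T) t)
    (h0 : 0 ≤ f 0) : ∀ t ∈ Set.Icc (0:ℝ) T, 0 ≤ f t := by
  intro t ht
  let a' : ℝ → ℝ := Set.IccExtend hT.le ((Set.Icc 0 T).domRestrict a)
  have ha' : Continuous a' := (continuousOn_iff_continuous_domRestrict.mp ha).Icc_extend'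
  have hae : ∀ x ∈ Set.Icc (0:ℝ) T, a' x = a x := fun x hx => by
    simp [a', Set.IccExtend_of_mem hT.le _ hx]
  let A : ℝ → ℝ := fun x => ∫ s in (0:ℝ)..x, a' s
  have hA : ∀ x, HasDerivAt A (a' x) x := fun x => ha'.integral_hasStrictDerivAt 0 x |>.hasDerivAt
  have hg : ∀ x ∈ Set.Icc (0:ℝ) T, HasDerivWithinAt (fun y => f y * Real.exp (A y))
      (b x * Real.exp (A x)) (Set.Icc 0 T) x := by
    intro x hx
    have h := (hf x hx).mul (hA x).exp.hasDerivWithinAt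
    refine h.congr_deriv ?_
    rw [hae x hx]
    ring
  have hmono : MonotoneOn (fun y => f y * Real.exp (A y)) (Set.Icc 0 T) := by
    apply monotoneOn_of_hasDerivWithinAt_nonneg (convex_Icc 0 T)
      (fun x hx => (hg x hx).continuousWithinAt)
      (fun x hx => (hg x (interior_subset hx)).mono interior_subset)
    intro x hx
    exact mul_nonneg (hb x (interior_subset hx)) (Real.exp_pos _).le
  have h1 := hmono (Set.left_mem_Icc.mpr hT.le) ht ht.1
  have h2 : 0 ≤ f 0 * Real.exp (A 0) := mul_nonneg h0 (Real.exp_pos _).le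
  exact nonneg_of_mul_nonneg_left (h2.trans h1) (Real.exp_pos _)

theorem stmt13 (ν c T : ℝ) (hν : 0 ≤ ν) (hT : 0 < T)
    (u : ℕ → ℝ → ℝ)
    (hcont : ∀ j, ContinuousOn (u j) (Set.Icc 0 T))
    (hode : ∀ j : ℕ, 1 ≤ j → ∀ t ∈ Set.Icc (0:ℝ) T,
      HasDerivWithinAt (u j)
        (-(ν * (2:ℝ) ^ (2 * j) * u j t)
          - (2:ℝ) ^ (c * (j:ℝ)) * u j t * u (j+1) t
          + (2:ℝ) ^ (c * ((j:ℝ) - 1)) * (u (j-1) t) ^ 2)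
        (Set.Icc 0 T) t)
    (hinit : ∀ j : ℕ, 1 ≤ j → 0 ≤ u j 0) :
    ∀ j : ℕ, 1 ≤ j → ∀ t ∈ Set.Icc (0:ℝ) T, 0 ≤ u j t := by
  intro j hj
  refine linear_ode_nonneg T hT (u j)
    (fun t => ν * (2:ℝ) ^ (2 * j) + (2:ℝ) ^ (c * (j:ℝ)) * u (j+1) t)
    (fun t => (2:ℝ) ^ (c * ((j:ℝ) - 1)) * (u (j-1) t) ^ 2)
    (continuousOn_const.add (continuousOn_const.mul (hcont (j+1))))
    (fun t _ => by positivity) (fun t ht => (hode j hj t ht).congr_deriv (by ring)) (hinit j hj)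
end

section
/- Let c ∈ [1,2], ν > 0, T > 0, and for i = 1,2 let uⁱ = (uⁱ_j)_{j≥0} : [0,T] → ℝ^ℕ be such that each component uⁱ_j is continuously differentiable, uⁱ(t) ∈ H for all t, uⁱ(t) ∈ H¹ for almost every t with ∫₀ᵀ |u¹(s)|²_{H¹} ds < ∞, and both satisfy, with the same continuous function f : [0,T] → ℝ: (uⁱ₀)′ + ν uⁱ₀ + uⁱ₀ uⁱ₁ = f, and for j ≥ 1, (uⁱ_j)′ + ν 2^{2j} uⁱ_j + 2^{cj} uⁱ_j uⁱ_{j+1} - 2^{c(j-1)} (uⁱ_{j-1})² = 0 on [0,T]. Set v := u¹ - u², and assume the energy identity holds: t ↦ |v(t)|² is differentiable with derivative 2 Σ_{j≥0} v_j(t) v_j′(t), and v(t) ∈ H¹ for almost every t. Then there is a constant C depending only on c and ν such that |v(t)|² ≤ |v(0)|² exp( C ∫₀ᵗ |u¹(s)|²_{H¹} ds ) for all t ∈ [0,T]. In particular, if u¹(0) = u²(0) then u¹ ≡ u² on [0,T]. -/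
open MeasureTheory

/-- The right-hand side of the dyadic shell model with forcing `f` in the zeroth component:
`u₀' = f - ν u₀ - u₀ u₁` and, for `j ≥ 1`,
`u_j' = -ν 2^{2j} u_j - 2^{cj} u_j u_{j+1} + 2^{c(j-1)} u_{j-1}²`. -/
noncomputable def shellRHS (c ν : ℝ) (f : ℝ → ℝ) (u : ℕ → ℝ → ℝ) (j : ℕ) (t : ℝ) : ℝ :=
  if j = 0 then f t - ν * u 0 t - u 0 t * u 1 t
  else -(ν * (2:ℝ) ^ (2 * j) * u j t)
        - (2:ℝ) ^ (c * (j:ℝ)) * u j t * u (j+1) t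
        + (2:ℝ) ^ (c * ((j:ℝ) - 1)) * (u (j-1) t) ^ 2


lemma shell_k_bound (c : ℝ) (hc : c ∈ Set.Icc (1:ℝ) 2) (j : ℕ) :
    0 ≤ (2:ℝ) ^ (c * (j:ℝ)) ∧ (2:ℝ) ^ (c * (j:ℝ)) ≤ (2:ℝ) ^ j * 2 ^ j := by
  refine ⟨by positivity, ?_⟩
  have h : (2:ℝ) ^ (c * (j:ℝ)) ≤ (2:ℝ) ^ ((2 * j : ℕ) : ℝ) := by
    apply Real.rpow_le_rpow_of_exponent_le (by norm_num)
    push_cast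
    exact mul_le_mul_of_nonneg_right hc.2 (by positivity)
  rw [Real.rpow_natCast] at h
  calc _ ≤ _ := h
    _ = _ := by rw [two_mul, pow_add]

lemma shell_young (ν W x z y : ℝ) (hν : 0 < ν) (hx : x ^ 2 ≤ W) :
    |x * z * y| ≤ ν / 2 * y ^ 2 + W / (2 * ν) * z ^ 2 := by
  have h1 : |x * z * y| ≤ ν / 2 * y ^ 2 + x ^ 2 / (2 * ν) * z ^ 2 := by
    have e : ν / 2 * y ^ 2 + x ^ 2 / (2 * ν) * z ^ 2
        = |x * z * y| + (ν * |y| - |x * z|) ^ 2 / (2 * ν) := by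
      rw [abs_mul, sub_sq, mul_pow, sq_abs, sq_abs]
      field_simp
      ring
    rw [e]
    have : 0 ≤ (ν * |y| - |x * z|) ^ 2 / (2 * ν) := by positivity
    linarith
  have h2 : x ^ 2 / (2 * ν) * z ^ 2 ≤ W / (2 * ν) * z ^ 2 := by gcongr
  linarith

/-- first trilinear term -/
lemma shell_P_bound (c ν : ℝ) (hc : c ∈ Set.Icc (1:ℝ) 2) (hν : 0 < ν) (w v : ℕ → ℝ)
    (hw : Summable fun j : ℕ => (2:ℝ) ^ (2 * j) * (w j) ^ 2) (j : ℕ) :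
    |(2:ℝ) ^ (c * (j:ℝ)) * w j * v j * v (j+1)| ≤
      ν / 2 * ((2:ℝ) ^ (2 * (j+1)) * (v (j+1)) ^ 2)
        + (∑' j : ℕ, (2:ℝ) ^ (2 * j) * (w j) ^ 2) / (2 * ν) * (v j) ^ 2 := by
  obtain ⟨h0, h1⟩ := shell_k_bound c hc j
  have hx : ((2:ℝ) ^ j * w j) ^ 2 ≤ ∑' j : ℕ, (2:ℝ) ^ (2 * j) * (w j) ^ 2 := by
    have := hw.le_tsum j (fun i _ => by positivity)
    calc _ = (2:ℝ) ^ (2 * j) * (w j) ^ 2 := by ring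
      _ ≤ _ := this
  have h2 := shell_young ν _ _ (v j) ((2:ℝ) ^ (j+1) * v (j+1)) hν hx
  have h3 : |(2:ℝ) ^ (c * (j:ℝ)) * w j * v j * v (j+1)|
      ≤ |(2:ℝ) ^ j * w j * v j * ((2:ℝ) ^ (j+1) * v (j+1))| := by
    have e1 : (2:ℝ) ^ (c * (j:ℝ)) * w j * v j * v (j+1)
        = (2:ℝ) ^ (c * (j:ℝ)) * (w j * v j * v (j+1)) := by ring
    have e2 : (2:ℝ) ^ j * w j * v j * ((2:ℝ) ^ (j+1) * v (j+1))
        = (2 * ((2:ℝ) ^ j * 2 ^ j)) * (w j * v j * v (j+1)) := by ring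
    rw [e1, e2, abs_mul, abs_mul _ (w j * v j * v (j+1))]
    apply mul_le_mul_of_nonneg_right _ (abs_nonneg _)
    rw [abs_of_nonneg h0, abs_of_nonneg (by positivity)]
    have : (0:ℝ) ≤ (2:ℝ) ^ j * 2 ^ j := by positivity
    linarith
  have e3 : ((2:ℝ) ^ (j+1) * v (j+1)) ^ 2 = (2:ℝ) ^ (2 * (j+1)) * (v (j+1)) ^ 2 := by ring
  rw [e3] at h2
  exact h3.trans h2

/-- second trilinear term -/
lemma shell_Q_bound (c ν : ℝ) (hc : c ∈ Set.Icc (1:ℝ) 2) (hν : 0 < ν) (w v : ℕ → ℝ)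
    (hw : Summable fun j : ℕ => (2:ℝ) ^ (2 * j) * (w j) ^ 2) (j : ℕ) :
    |(2:ℝ) ^ (c * (j:ℝ)) * (v j) ^ 2 * w (j+1)| ≤
      ν / 2 * ((2:ℝ) ^ (2 * j) * (v j) ^ 2)
        + (∑' j : ℕ, (2:ℝ) ^ (2 * j) * (w j) ^ 2) / (2 * ν) * (v j) ^ 2 := by
  obtain ⟨h0, h1⟩ := shell_k_bound c hc j
  have hx : ((2:ℝ) ^ (j+1) * w (j+1)) ^ 2 ≤ ∑' j : ℕ, (2:ℝ) ^ (2 * j) * (w j) ^ 2 := by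
    have := hw.le_tsum (j+1) (fun i _ => by positivity)
    calc _ = (2:ℝ) ^ (2 * (j+1)) * (w (j+1)) ^ 2 := by ring
      _ ≤ _ := this
  have h2 := shell_young ν _ _ (v j) ((2:ℝ) ^ j * v j) hν hx
  have h3 : |(2:ℝ) ^ (c * (j:ℝ)) * (v j) ^ 2 * w (j+1)|
      ≤ |(2:ℝ) ^ (j+1) * w (j+1) * v j * ((2:ℝ) ^ j * v j)| := by
    have e1 : (2:ℝ) ^ (c * (j:ℝ)) * (v j) ^ 2 * w (j+1)
        = (2:ℝ) ^ (c * (j:ℝ)) * ((v j) ^ 2 * w (j+1)) := by ring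
    have e2 : (2:ℝ) ^ (j+1) * w (j+1) * v j * ((2:ℝ) ^ j * v j)
        = (2 * ((2:ℝ) ^ j * 2 ^ j)) * ((v j) ^ 2 * w (j+1)) := by ring
    rw [e1, e2, abs_mul, abs_mul _ ((v j) ^ 2 * w (j+1))]
    apply mul_le_mul_of_nonneg_right _ (abs_nonneg _)
    rw [abs_of_nonneg h0, abs_of_nonneg (by positivity)]
    have : (0:ℝ) ≤ (2:ℝ) ^ j * 2 ^ j := by positivity
    linarith
  have e3 : ((2:ℝ) ^ j * v j) ^ 2 = (2:ℝ) ^ (2 * j) * (v j) ^ 2 := by ring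
  rw [e3] at h2
  exact h3.trans h2

/-- The pointwise-in-time energy inequality. -/
lemma shell_energy (c ν : ℝ) (hc : c ∈ Set.Icc (1:ℝ) 2) (hν : 0 < ν) (w v : ℕ → ℝ)
    (hw : Summable fun j : ℕ => (2:ℝ) ^ (2 * j) * (w j) ^ 2)
    (hv : Summable fun j : ℕ => (2:ℝ) ^ (2 * j) * (v j) ^ 2)
    (a : ℕ → ℝ)
    (ha0 : a 0 = -(ν * ((2:ℝ) ^ (2 * 0) * (v 0) ^ 2))
      - (2:ℝ) ^ (c * ((0:ℕ):ℝ)) * w 0 * v 0 * v (0+1) - (2:ℝ) ^ (c * ((0:ℕ):ℝ)) * (v 0) ^ 2 * w (0+1)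
      + (2:ℝ) ^ (c * ((0:ℕ):ℝ)) * v 0 * v 0 * v (0+1))
    (ha : ∀ j : ℕ, a (j+1) = -(ν * ((2:ℝ) ^ (2 * (j+1)) * (v (j+1)) ^ 2))
      - (2:ℝ) ^ (c * ((j+1:ℕ):ℝ)) * w (j+1) * v (j+1) * v (j+1+1)
      - (2:ℝ) ^ (c * ((j+1:ℕ):ℝ)) * (v (j+1)) ^ 2 * w (j+1+1)
      + (2:ℝ) ^ (c * ((j+1:ℕ):ℝ)) * v (j+1) * v (j+1) * v (j+1+1)
      + 2 * ((2:ℝ) ^ (c * (j:ℝ)) * w j * v j * v (j+1))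
      - (2:ℝ) ^ (c * (j:ℝ)) * v j * v j * v (j+1)) :
    2 * ∑' j, a j ≤ 2 / ν * (∑' j : ℕ, (2:ℝ) ^ (2 * j) * (w j) ^ 2) * ∑' j : ℕ, (v j) ^ 2 := by
  have hv0 : Summable fun j : ℕ => (v j) ^ 2 := by
    refine Summable.of_nonneg_of_le (fun j => by positivity) (fun j => ?_) hv
    have : (1:ℝ) ≤ (2:ℝ) ^ (2 * j) := one_le_pow₀ (by norm_num)
    nlinarith [sq_nonneg (v j)]
  have hv1 : Summable fun j : ℕ => (2:ℝ) ^ (2 * (j+1)) * (v (j+1)) ^ 2 :=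
    (summable_nat_add_iff (f := fun j : ℕ => (2:ℝ) ^ (2 * j) * (v j) ^ 2) 1).2 hv
  set W := ∑' j : ℕ, (2:ℝ) ^ (2 * j) * (w j) ^ 2 with hW
  set L : ℕ → ℝ := fun j => (2:ℝ) ^ (2 * j) * (v j) ^ 2 with hL
  set P : ℕ → ℝ := fun j => (2:ℝ) ^ (c * (j:ℝ)) * w j * v j * v (j+1) with hP
  set Q : ℕ → ℝ := fun j => (2:ℝ) ^ (c * (j:ℝ)) * (v j) ^ 2 * w (j+1) with hQ
  set R : ℕ → ℝ := fun j => (2:ℝ) ^ (c * (j:ℝ)) * v j * v j * v (j+1) with hR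
  have bP : Summable fun j => ν / 2 * L (j+1) + W / (2 * ν) * (v j) ^ 2 :=
    (hv1.mul_left _).add (hv0.mul_left _)
  have bQ : Summable fun j => ν / 2 * L j + W / (2 * ν) * (v j) ^ 2 :=
    (hv.mul_left _).add (hv0.mul_left _)
  have sP : Summable P := Summable.of_norm_bounded bP (fun j => shell_P_bound c ν hc hν w v hw j)
  have sQ : Summable Q := Summable.of_norm_bounded bQ (fun j => shell_Q_bound c ν hc hν w v hw j)
  have sR : Summable R := Summable.of_norm_bounded
    ((hv1.mul_left _).add (hv0.mul_left _)) (fun j => shell_P_bound c ν hc hν v v hv j)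
  have iP : ∑' j, P j ≤ ν / 2 * ∑' j, L j + W / (2 * ν) * ∑' j, (v j) ^ 2 := by
    have h1 : ∑' j, P j ≤ ∑' j, (ν / 2 * L (j+1) + W / (2 * ν) * (v j) ^ 2) :=
      sP.tsum_le_tsum (fun j => (le_abs_self _).trans (shell_P_bound c ν hc hν w v hw j)) bP
    rw [Summable.tsum_add (hv1.mul_left _) (hv0.mul_left _), tsum_mul_left, tsum_mul_left] at h1
    have h2 : ∑' j, L (j+1) ≤ ∑' j, L j := by
      rw [hv.tsum_eq_zero_add]
      have : 0 ≤ L 0 := by simp only [hL]; positivity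
      linarith
    have h3 : ν / 2 * ∑' j, L (j+1) ≤ ν / 2 * ∑' j, L j := by gcongr
    linarith
  have iQ : -∑' j, Q j ≤ ν / 2 * ∑' j, L j + W / (2 * ν) * ∑' j, (v j) ^ 2 := by
    have h1 : ∑' j, -Q j ≤ ∑' j, (ν / 2 * L j + W / (2 * ν) * (v j) ^ 2) :=
      sQ.neg.tsum_le_tsum (fun j => (neg_le_abs _).trans (shell_Q_bound c ν hc hν w v hw j)) bQ
    rw [Summable.tsum_add (hv.mul_left _) (hv0.mul_left _), tsum_mul_left, tsum_mul_left,
      tsum_neg] at h1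
    exact h1
  let b : ℕ → ℝ := fun j => -(ν * L j) - P j - Q j + R j
  let d : ℕ → ℝ := fun j => 2 * P j - R j
  have hb : HasSum b (-(ν * ∑' j, L j) - ∑' j, P j - ∑' j, Q j + ∑' j, R j) :=
    ((((hv.hasSum.mul_left ν).neg).sub sP.hasSum).sub sQ.hasSum).add sR.hasSum
  have hd : HasSum d (2 * ∑' j, P j - ∑' j, R j) := (sP.hasSum.mul_left 2).sub sR.hasSum
  have ha0' : a 0 = b 0 := ha0
  have ha' : ∀ j, a (j+1) = b (j+1) + d j := by
    intro j
    rw [ha j]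
    simp only [b, d, hL, hP, hQ, hR]
    ring
  have hb1 : HasSum (fun j => b (j+1)) (∑' j, b j - b 0) := by
    have := (hasSum_nat_add_iff' (f := b) 1).2 hb.summable.hasSum
    simpa using this
  have hA : HasSum (fun j => a (j+1)) (∑' j, b j - b 0 + ∑' j, d j) := by
    have := hb1.add hd.summable.hasSum
    simpa only [ha'] using this
  have sA : Summable a := (summable_nat_add_iff 1).1 hA.summable
  have e : ∑' j, a j = -(ν * ∑' j, L j) + ∑' j, P j - ∑' j, Q j := by
    rw [sA.tsum_eq_zero_add, hA.tsum_eq, ha0', hb.tsum_eq, hd.tsum_eq]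
    ring
  rw [e]
  have : 2 / ν * W * ∑' j, (v j) ^ 2 = 4 * (W / (2 * ν) * ∑' j, (v j) ^ 2) := by
    field_simp
    ring
  rw [this]
  linarith

lemma shell_energy_rhs (c ν : ℝ) (hc : c ∈ Set.Icc (1:ℝ) 2) (hν : 0 < ν) (f : ℝ → ℝ)
    (u1 u2 : ℕ → ℝ → ℝ) (t : ℝ)
    (h1 : Summable fun j : ℕ => (2:ℝ) ^ (2 * j) * (u1 j t) ^ 2)
    (h2 : Summable fun j : ℕ => (2:ℝ) ^ (2 * j) * (u2 j t) ^ 2) :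
    2 * ∑' j : ℕ, (u1 j t - u2 j t) * (shellRHS c ν f u1 j t - shellRHS c ν f u2 j t)
      ≤ 2 / ν * (∑' j : ℕ, (2:ℝ) ^ (2 * j) * (u1 j t) ^ 2) *
        ∑' j : ℕ, (u1 j t - u2 j t) ^ 2 := by
  refine shell_energy c ν hc hν (fun j => u1 j t) (fun j => u1 j t - u2 j t) h1 ?_ _ ?_ ?_
  · refine Summable.of_nonneg_of_le (fun j => by positivity) (fun j => ?_)
      ((h1.mul_left 2).add (h2.mul_left 2))
    have : (0:ℝ) ≤ (2:ℝ) ^ (2 * j) := by positivity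
    nlinarith [mul_nonneg this (sq_nonneg (u1 j t + u2 j t))]
  · simp [shellRHS]
    ring
  · intro j
    have : ((j + 1 : ℕ) : ℝ) - 1 = j := by push_cast; ring
    simp only [shellRHS, this, Nat.add_sub_cancel, Nat.add_eq_zero_iff, one_ne_zero, and_false,
      if_false]
    ring

/-- Gronwall with integrable coefficient and differential inequality a.e. -/
lemma shell_gronwall (T : ℝ) (E E' φ : ℝ → ℝ) (hE0 : ∀ t, 0 ≤ E t) (hφ0 : ∀ t, 0 ≤ φ t)
    (hE : ∀ t ∈ Set.Icc (0:ℝ) T, HasDerivWithinAt E (E' t) (Set.Icc 0 T) t)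
    (hφ : IntegrableOn φ (Set.Icc 0 T))
    (hle : ∀ᵐ t ∂(volume.restrict (Set.Icc (0:ℝ) T)), E' t ≤ φ t * E t)
    (t : ℝ) (ht : t ∈ Set.Icc (0:ℝ) T) :
    E t ≤ E 0 * Real.exp (∫ s in Set.Icc (0:ℝ) t, φ s) := by
  have key : ∀ ε : ℝ, 0 < ε → E t + ε ≤ (E 0 + ε) * Real.exp (∫ s in Set.Icc (0:ℝ) t, φ s) := by
    intro ε hε
    have hpos : ∀ s, 0 < E s + ε := fun s => by linarith [hE0 s]
    have hsub : Set.Icc (0:ℝ) t ⊆ Set.Icc 0 T := Set.Icc_subset_Icc_right ht.2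
    let ψ : ℝ → ℝ := fun s => max (φ s) (E' s / (E s + ε))
    have hae : ∀ᵐ s ∂(volume.restrict (Set.Icc (0:ℝ) t)), φ s = ψ s := by
      have := ae_mono (Measure.restrict_mono hsub le_rfl) hle
      filter_upwards [this] with s hs
      refine (max_eq_left ?_).symm
      rw [div_le_iff₀ (hpos s)]
      nlinarith [hφ0 s]
    have hψ : IntegrableOn ψ (Set.Icc 0 t) := (hφ.mono_set hsub).congr hae
    have hlog : ∀ s ∈ Set.Icc (0:ℝ) T, HasDerivWithinAt (fun s => Real.log (E s + ε))
        (E' s / (E s + ε)) (Set.Icc 0 T) s := fun s hs =>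
      ((hE s hs).add_const ε).log (hpos s).ne'
    have h := intervalIntegral.sub_le_integral_of_hasDeriv_right_of_le (a := 0) (b := t)
      (g := fun s => Real.log (E s + ε)) (g' := fun s => E' s / (E s + ε)) (φ := ψ) ht.1
      (fun s hs => ((hlog s (hsub hs)).continuousWithinAt).mono hsub)
      (fun s hs => by
        have hs' : s ∈ Set.Icc (0:ℝ) T := ⟨hs.1.le, hs.2.le.trans ht.2⟩
        exact ((hlog s hs').hasDerivAt
          (Icc_mem_nhds hs.1 (hs.2.trans_le ht.2))).hasDerivWithinAt)
      hψ (fun s _ => le_max_right _ _)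
    rw [intervalIntegral.integral_of_le ht.1, ← integral_Icc_eq_integral_Ioc,
      ← integral_congr_ae hae] at h
    have h' : Real.log (E t + ε) ≤ Real.log (E 0 + ε) + ∫ s in Set.Icc (0:ℝ) t, φ s := by
      linarith
    have h'' := Real.exp_le_exp.2 h'
    rwa [Real.exp_add, Real.exp_log (hpos _), Real.exp_log (hpos _)] at h''
  set X := Real.exp (∫ s in Set.Icc (0:ℝ) t, φ s) with hX
  have hXp : 0 < X := Real.exp_pos _
  refine le_of_forall_pos_le_add (fun δ hδ => ?_)
  have := key (δ / X) (by positivity)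
  rw [add_mul, div_mul_cancel₀ _ hXp.ne'] at this
  have : 0 < δ / X := by positivity
  linarith

theorem stmt14 (c : ℝ) (hc : c ∈ Set.Icc (1:ℝ) 2) (ν : ℝ) (hν : 0 < ν) :
    ∃ C : ℝ, 0 < C ∧
      ∀ (T : ℝ), 0 < T →
      ∀ (f : ℝ → ℝ) (u1 u2 : ℕ → ℝ → ℝ),
      ContinuousOn f (Set.Icc 0 T) →
      (∀ j, ContinuousOn (u1 j) (Set.Icc 0 T)) →
      (∀ j, ContinuousOn (u2 j) (Set.Icc 0 T)) →
      -- both solve the shell model with the same forcing `f`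
      (∀ j : ℕ, ∀ t ∈ Set.Icc (0:ℝ) T,
        HasDerivWithinAt (u1 j) (shellRHS c ν f u1 j t) (Set.Icc 0 T) t) →
      (∀ j : ℕ, ∀ t ∈ Set.Icc (0:ℝ) T,
        HasDerivWithinAt (u2 j) (shellRHS c ν f u2 j t) (Set.Icc 0 T) t) →
      -- `uⁱ(t) ∈ H` for all `t`
      (∀ t ∈ Set.Icc (0:ℝ) T, Summable fun j : ℕ => (u1 j t) ^ 2) →
      (∀ t ∈ Set.Icc (0:ℝ) T, Summable fun j : ℕ => (u2 j t) ^ 2) →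
      -- `uⁱ(t) ∈ H¹` for a.e. `t` (in particular `v(t) ∈ H¹` for a.e. `t`)
      (∀ᵐ t ∂(volume.restrict (Set.Icc (0:ℝ) T)),
        (Summable fun j : ℕ => (2:ℝ) ^ (2 * j) * (u1 j t) ^ 2) ∧
        (Summable fun j : ℕ => (2:ℝ) ^ (2 * j) * (u2 j t) ^ 2)) →
      -- `∫₀ᵀ |u¹(s)|²_{H¹} ds < ∞`
      IntegrableOn (fun t => ∑' j : ℕ, (2:ℝ) ^ (2 * j) * (u1 j t) ^ 2) (Set.Icc 0 T) →
      -- the energy identity for `v = u¹ - u²`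
      (∀ t ∈ Set.Icc (0:ℝ) T,
        HasDerivWithinAt (fun s => ∑' j : ℕ, (u1 j s - u2 j s) ^ 2)
          (2 * ∑' j : ℕ, (u1 j t - u2 j t) *
            (shellRHS c ν f u1 j t - shellRHS c ν f u2 j t))
          (Set.Icc 0 T) t) →
      (∀ t ∈ Set.Icc (0:ℝ) T,
        (∑' j : ℕ, (u1 j t - u2 j t) ^ 2)
          ≤ (∑' j : ℕ, (u1 j 0 - u2 j 0) ^ 2) *
            Real.exp (C * ∫ s in Set.Icc (0:ℝ) t,
              ∑' j : ℕ, (2:ℝ) ^ (2 * j) * (u1 j s) ^ 2)) ∧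
      ((∀ j, u1 j 0 = u2 j 0) →
        ∀ j, ∀ t ∈ Set.Icc (0:ℝ) T, u1 j t = u2 j t) := by
  refine ⟨2 / ν, by positivity, ?_⟩
  intro T hT f u1 u2 _ _ _ _ _ hs1 hs2 hae hint hE
  have main : ∀ t ∈ Set.Icc (0:ℝ) T,
        (∑' j : ℕ, (u1 j t - u2 j t) ^ 2)
          ≤ (∑' j : ℕ, (u1 j 0 - u2 j 0) ^ 2) *
            Real.exp (2 / ν * ∫ s in Set.Icc (0:ℝ) t,
              ∑' j : ℕ, (2:ℝ) ^ (2 * j) * (u1 j s) ^ 2) := by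
    intro t ht
    rw [← integral_const_mul]
    refine shell_gronwall T (fun s => ∑' j : ℕ, (u1 j s - u2 j s) ^ 2) _
      (fun s => 2 / ν * ∑' j : ℕ, (2:ℝ) ^ (2 * j) * (u1 j s) ^ 2)
      (fun s => tsum_nonneg fun j => by positivity)
      (fun s => mul_nonneg (by positivity) (tsum_nonneg fun j => by positivity))
      hE (hint.const_mul _) ?_ t ht
    filter_upwards [hae] with s hs
    exact shell_energy_rhs c ν hc hν f u1 u2 s hs.1 hs.2
  refine ⟨main, fun h0 j t ht => ?_⟩
  have h := main t ht
  simp only [h0, sub_self, ne_eq, OfNat.ofNat_ne_zero, not_false_eq_true, zero_pow, tsum_zero,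
    zero_mul] at h
  have hs : Summable fun j : ℕ => (u1 j t - u2 j t) ^ 2 := by
    refine Summable.of_nonneg_of_le (fun j => by positivity) (fun j => ?_)
      (((hs1 t ht).mul_left 2).add ((hs2 t ht).mul_left 2))
    nlinarith [sq_nonneg (u1 j t + u2 j t)]
  have hj := hs.le_tsum j (fun i _ => by positivity)
  have : (u1 j t - u2 j t) ^ 2 = 0 := le_antisymm (hj.trans h) (sq_nonneg _)
  exact sub_eq_zero.1 (pow_eq_zero_iff (two_ne_zero) |>.1 this)
end

section
/- Let c ∈ [1,2] and ν > 0. There is a constant C depending only on c such that for all u, ρ ∈ H¹, 2 |⟨B(ρ,u), ρ⟩| ≤ ν |ρ|²_{H¹} + C ν^{-(c-1)/(3-c)} |u|_{H¹}^{2/(3-c)} |ρ|², where ⟨B(ρ,u), ρ⟩ = Σ_{j≥0} ( 2^{cj} ρ_j u_{j+1} - 2^{c(j-1)} ρ_{j-1} u_{j-1} ) ρ_j (an absolutely convergent series). -/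
theorem young_aux (c : ℝ) (h1 : 1 ≤ c) (h2 : c ≤ 2) (ν U x : ℝ) (hν : 0 < ν) (hU : 0 ≤ U) (hx : 0 < x) :
    4 * U * x ^ ((c-1)/2) ≤ ν * x +
      (4:ℝ) ^ ((2:ℝ)/(3-c)) * ν ^ (-((c-1)/(3-c))) * U ^ ((2:ℝ)/(3-c)) := by
  have h3 : (3 - c) ≠ 0 := by linarith
  set K := (4:ℝ) ^ ((2:ℝ)/(3-c)) * ν ^ (-((c-1)/(3-c))) * U ^ ((2:ℝ)/(3-c)) with hK
  have hK0 : 0 ≤ K := by positivity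
  have key := Real.geom_mean_le_arith_mean2_weighted (w₁ := (c-1)/2) (w₂ := (3-c)/2)
    (p₁ := ν * x) (p₂ := K) (by linarith) (by linarith) (by positivity) hK0 (by ring)
  have e : K ^ ((3-c)/2) = 4 * U * ν ^ (-((c-1)/2)) := by
    rw [hK, Real.mul_rpow (by positivity) (by positivity),
      Real.mul_rpow (by positivity) (by positivity), ← Real.rpow_mul (by norm_num),
      ← Real.rpow_mul hν.le, ← Real.rpow_mul hU]
    have a : (2:ℝ)/(3-c) * ((3-c)/2) = 1 := by field_simp
    have b : -((c-1)/(3-c)) * ((3-c)/2) = -((c-1)/2) := by field_simp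
    rw [a, b, Real.rpow_one, Real.rpow_one]; ring
  have e2 : ν ^ ((c-1)/2) * ν ^ (-((c-1)/2)) = 1 := by
    rw [← Real.rpow_add hν]; simp
  rw [e, Real.mul_rpow hν.le hx.le] at key
  have e3 : ν ^ ((c-1)/2) * x ^ ((c-1)/2) * (4 * U * ν ^ (-((c-1)/2))) = 4 * U * x ^ ((c-1)/2) := by
    linear_combination (4 * U * x ^ ((c-1)/2)) * e2
  rw [e3] at key
  have hνx : 0 ≤ ν * x := by positivity
  nlinarith [mul_nonneg (by linarith : 0 ≤ 1 - (c-1)/2) hνx, mul_nonneg (by linarith : 0 ≤ 1 - (3-c)/2) hK0]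

theorem coord_aux (u : ℕ → ℝ) (hu : Summable (fun j : ℕ => (2:ℝ) ^ (2 * (j:ℝ)) * u j ^ 2)) (j : ℕ) :
    (2:ℝ) ^ (j:ℝ) * |u j| ≤ Hnorm 1 u := by
  unfold Hnorm
  apply Real.le_sqrt_of_sq_le
  have := hu.le_tsum j (fun i _ => by positivity)
  simp only [mul_one]
  refine le_trans (le_of_eq ?_) this
  rw [mul_pow, sq_abs, ← Real.rpow_natCast, ← Real.rpow_mul (by norm_num)]
  congr 2
  push_cast; ring

theorem stmt15 (c : ℝ) (hc : c ∈ Set.Icc (1:ℝ) 2) :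
    ∃ C : ℝ, 0 < C ∧
      ∀ (ν : ℝ), 0 < ν →
      ∀ u ρ : ℕ → ℝ,
      Summable (fun j : ℕ => (2:ℝ) ^ (2 * (j:ℝ)) * u j ^ 2) →
      Summable (fun j : ℕ => (2:ℝ) ^ (2 * (j:ℝ)) * ρ j ^ 2) →
      Summable (fun j : ℕ => |Bop c ρ u j * ρ j|) ∧
      2 * |∑' j : ℕ, Bop c ρ u j * ρ j|
        ≤ ν * (Hnorm 1 ρ) ^ 2
          + C * ν ^ (-((c-1)/(3-c))) * (Hnorm 1 u) ^ ((2:ℝ)/(3-c)) * (Hnorm 0 ρ) ^ 2 := by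
  obtain ⟨h1, h2⟩ := hc
  refine ⟨(4:ℝ) ^ ((2:ℝ)/(3-c)), by positivity, ?_⟩
  intro ν hν u ρ hu hρ
  set U := Hnorm 1 u with hUdef
  have hU : 0 ≤ U := Real.sqrt_nonneg _
  have hco := coord_aux u hu
  set w : ℕ → ℝ := fun j => (2:ℝ) ^ ((c-1) * (j:ℝ)) with hw
  have hw0 : ∀ j, 0 < w j := fun j => by simp only [hw]; positivity
  have hwm : ∀ j, w j ≤ w (j+1) := fun j => by
    simp only [hw]
    apply Real.rpow_le_rpow_of_exponent_le (by norm_num)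
    push_cast; nlinarith
  have hcj : ∀ j : ℕ, (2:ℝ) ^ (c * (j:ℝ)) = w j * 2 ^ (j:ℝ) := fun j => by
    simp only [hw]; rw [← Real.rpow_add (by norm_num)]; congr 1; ring
  have hA : ∀ j : ℕ, (2:ℝ) ^ (c * (j:ℝ)) * |u j| ≤ w j * U := fun j => by
    rw [hcj, mul_assoc]; exact mul_le_mul_of_nonneg_left (hco j) (hw0 j).le
  have hA' : ∀ j : ℕ, (2:ℝ) ^ (c * (j:ℝ)) * |u (j+1)| ≤ w j * U := fun j => by
    rw [hcj, mul_assoc]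
    refine mul_le_mul_of_nonneg_left (le_trans ?_ (hco (j+1))) (hw0 j).le
    refine mul_le_mul_of_nonneg_right ?_ (abs_nonneg _)
    apply Real.rpow_le_rpow_of_exponent_le (by norm_num)
    push_cast; linarith
  set g : ℕ → ℝ := fun j => w j * U * ρ j ^ 2 with hg
  have hg0 : ∀ j, 0 ≤ g j := fun j => by
    have := hw0 j
    simp only [hg]; positivity
  have hρ0 : Summable (fun j : ℕ => ρ j ^ 2) := by
    refine Summable.of_nonneg_of_le (fun j => by positivity) (fun j => ?_) hρ
    have : (1:ℝ) ≤ (2:ℝ) ^ (2 * (j:ℝ)) := Real.one_le_rpow (by norm_num) (by positivity)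
    nlinarith [sq_nonneg (ρ j)]
  set K := (4:ℝ) ^ ((2:ℝ)/(3-c)) * ν ^ (-((c-1)/(3-c))) * U ^ ((2:ℝ)/(3-c)) with hK
  have hy : ∀ j, 4 * g j ≤ ν * ((2:ℝ) ^ (2 * (j:ℝ)) * ρ j ^ 2) + K * ρ j ^ 2 := fun j => by
    have := young_aux c h1 h2 ν U ((2:ℝ) ^ (2 * (j:ℝ))) hν hU (by positivity)
    rw [← Real.rpow_mul (by norm_num), show 2 * (j:ℝ) * ((c-1)/2) = (c-1) * (j:ℝ) by ring] at this
    have := mul_le_mul_of_nonneg_right this (sq_nonneg (ρ j))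
    simp only [hg, hw]
    linarith
  have hR : Summable (fun j : ℕ => ν * ((2:ℝ) ^ (2 * (j:ℝ)) * ρ j ^ 2) + K * ρ j ^ 2) :=
    (hρ.mul_left ν).add (hρ0.mul_left K)
  have h4g : Summable (fun j => 4 * g j) :=
    Summable.of_nonneg_of_le (fun j => by have := hg0 j; positivity) hy hR
  have hgs : Summable g := by
    have := h4g.mul_left (1/4)
    refine this.congr (fun j => by ring)
  set h : ℕ → ℝ := fun j => if j = 0 then 0 else g (j-1) with hh
  have hh1 : (fun j => h (j+1)) = g := by ext j; simp [hh]
  have hhs : Summable h := by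
    rw [← summable_nat_add_iff 1, hh1]; exact hgs
  have hht : ∑' j, h j = ∑' j, g j := by
    rw [hhs.tsum_eq_zero_add, hh1]; simp [hh]
  have hterm : ∀ j, |Bop c ρ u j * ρ j| ≤ 3/2 * g j + 1/2 * h j := by
    intro j
    have f1 : |(2:ℝ) ^ (c * (j:ℝ)) * ρ j * u (j+1) * ρ j| ≤ g j := by
      have e : |(2:ℝ) ^ (c * (j:ℝ)) * ρ j * u (j+1) * ρ j| =
          (2:ℝ) ^ (c * (j:ℝ)) * |u (j+1)| * ρ j ^ 2 := by
        rw [abs_mul, abs_mul, abs_mul, abs_of_pos (by positivity : (0:ℝ) < 2 ^ (c * (j:ℝ))),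
          ← sq_abs (ρ j)]; ring
      rw [e]
      exact mul_le_mul_of_nonneg_right (hA' j) (sq_nonneg _)
    rcases j with _ | k
    · have := hg0 0
      simp only [Bop, hh, if_true, sub_zero]
      exact le_trans f1 (by linarith)
    · have f2 : |(2:ℝ) ^ (c * (k:ℝ)) * ρ k * u k * ρ (k+1)| ≤ 1/2 * g k + 1/2 * g (k+1) := by
        have e : |(2:ℝ) ^ (c * (k:ℝ)) * ρ k * u k * ρ (k+1)| =
            (2:ℝ) ^ (c * (k:ℝ)) * |u k| * (|ρ k| * |ρ (k+1)|) := by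
          rw [abs_mul, abs_mul, abs_mul, abs_of_pos (by positivity : (0:ℝ) < 2 ^ (c * (k:ℝ)))]; ring
        rw [e]
        have s1 := mul_le_mul_of_nonneg_right (hA k)
          (by positivity : 0 ≤ |ρ k| * |ρ (k+1)|)
        have s2 : |ρ k| * |ρ (k+1)| ≤ 1/2 * ρ k ^ 2 + 1/2 * ρ (k+1) ^ 2 := by
          rw [← sq_abs (ρ k), ← sq_abs (ρ (k+1))]
          nlinarith [sq_nonneg (|ρ k| - |ρ (k+1)|)]
        have s3 := mul_le_mul_of_nonneg_left s2 (mul_nonneg (hw0 k).le hU)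
        have s4 : w k * U * ρ (k+1) ^ 2 ≤ w (k+1) * U * ρ (k+1) ^ 2 :=
          mul_le_mul_of_nonneg_right (mul_le_mul_of_nonneg_right (hwm k) hU) (sq_nonneg _)
        simp only [hg]
        linarith
      have e : Bop c ρ u (k+1) * ρ (k+1) =
          (2:ℝ) ^ (c * ((k+1:ℕ):ℝ)) * ρ (k+1) * u (k+1+1) * ρ (k+1)
            - (2:ℝ) ^ (c * (k:ℝ)) * ρ k * u k * ρ (k+1) := by
        simp [Bop, sub_mul]
      have hk : h (k+1) = g k := by simp [hh]
      rw [e, hk]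
      have := abs_sub ((2:ℝ) ^ (c * ((k+1:ℕ):ℝ)) * ρ (k+1) * u (k+1+1) * ρ (k+1))
        ((2:ℝ) ^ (c * (k:ℝ)) * ρ k * u k * ρ (k+1))
      linarith
  have hBs : Summable (fun j => 3/2 * g j + 1/2 * h j) :=
    (hgs.mul_left _).add (hhs.mul_left _)
  have hS : Summable (fun j : ℕ => |Bop c ρ u j * ρ j|) :=
    Summable.of_nonneg_of_le (fun j => abs_nonneg _) hterm hBs
  refine ⟨hS, ?_⟩
  have t1 : |∑' j : ℕ, Bop c ρ u j * ρ j| ≤ ∑' j : ℕ, |Bop c ρ u j * ρ j| := by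
    have := norm_tsum_le_tsum_norm (f := fun j : ℕ => Bop c ρ u j * ρ j) hS
    simpa only [Real.norm_eq_abs] using this
  have t2 := hS.tsum_le_tsum hterm hBs
  rw [(hgs.mul_left _).tsum_add (hhs.mul_left _), tsum_mul_left, tsum_mul_left, hht] at t2
  have t3 := h4g.tsum_le_tsum hy hR
  rw [(hρ.mul_left ν).tsum_add (hρ0.mul_left K), tsum_mul_left, tsum_mul_left, tsum_mul_left] at t3
  have n1 : Hnorm 1 ρ ^ 2 = ∑' j : ℕ, (2:ℝ) ^ (2 * (j:ℝ)) * ρ j ^ 2 := by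
    unfold Hnorm
    rw [Real.sq_sqrt (tsum_nonneg (fun j => by positivity))]
    simp only [mul_one]
  have n0 : Hnorm 0 ρ ^ 2 = ∑' j : ℕ, ρ j ^ 2 := by
    unfold Hnorm
    rw [Real.sq_sqrt (tsum_nonneg (fun j => by positivity))]
    simp
  rw [n1, n0]
  linarith
end

section
/- Let c ∈ [1,2] and N ≥ 0. There is a constant C depending only on c such that for all u, ρ ∈ H¹, writing ρ_l for the sequence agreeing with ρ in components 0,…,N and zero elsewhere, and ρ_h := ρ - ρ_l, one has |⟨B(u,ρ_l), ρ_h⟩| + |⟨B(ρ_l,u), ρ_h⟩| ≤ C |u|_{H¹} |ρ_h| |ρ_l|^{2-c} |ρ_l|_{H¹}^{c-1}, and |⟨B(ρ_h,u), ρ_h⟩| ≤ C |u|_{H¹} |ρ_h|_{H¹}^{c-1} |ρ_h|^{3-c} (all pairings being absolutely convergent series). -/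
/-- The low-mode part of `ρ`: components `0,…,N` of `ρ`, and `0` beyond. -/
def lowPart (N : ℕ) (ρ : ℕ → ℝ) : ℕ → ℝ := fun j => if j ≤ N then ρ j else 0

/-- The high-mode part of `ρ`: `ρ - lowPart N ρ`. -/
def highPart (N : ℕ) (ρ : ℕ → ℝ) : ℕ → ℝ := fun j => ρ j - lowPart N ρ j

lemma interp_aux (x y : ℕ → ℝ) (θ : ℝ) (h0 : 0 ≤ θ) (h1 : θ < 1) (hx : ∀ j, 0 ≤ x j)
    (hxy : ∀ j, x j ≤ y j) (hy : Summable y) :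
    Summable (fun j => x j ^ (1 - θ) * y j ^ θ) ∧
      ∑' j, x j ^ (1 - θ) * y j ^ θ ≤ (∑' j, x j) ^ (1 - θ) * (∑' j, y j) ^ θ := by
  have hsx : Summable x := Summable.of_nonneg_of_le hx hxy hy
  have hy0 : ∀ j, 0 ≤ y j := fun j => (hx j).trans (hxy j)
  have hXY : ∑' j, x j ≤ ∑' j, y j := hsx.tsum_le_tsum hxy hy
  rcases (tsum_nonneg hx).eq_or_lt with hX | hX
  · have hz : ∀ j, x j = 0 := fun j =>
      le_antisymm (by rw [hX]; exact hsx.le_tsum j (fun i _ => hx i)) (hx j)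
    have : (fun j => x j ^ (1 - θ) * y j ^ θ) = fun _ => 0 := by
      funext j
      rw [hz j, Real.zero_rpow (by linarith), zero_mul]
    rw [this]
    refine ⟨summable_zero, ?_⟩
    rw [tsum_zero]
    have p1 : 0 ≤ ∑' j, x j := tsum_nonneg hx
    have p2 : 0 ≤ ∑' j, y j := tsum_nonneg hy0
    positivity
  · set X := ∑' j, x j with hXd
    set Y := ∑' j, y j with hYd
    have hY : 0 < Y := hX.trans_le hXY
    have key : ∀ j, x j ^ (1 - θ) * y j ^ θ ≤
        X ^ (1 - θ) * Y ^ θ * ((1 - θ) * (x j / X) + θ * (y j / Y)) := by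
      intro j
      have := Real.geom_mean_le_arith_mean2_weighted (w₁ := 1 - θ) (w₂ := θ) (by linarith) h0
        (div_nonneg (hx j) hX.le) (div_nonneg (hy0 j) hY.le) (by ring)
      rw [Real.div_rpow (hx j) hX.le, Real.div_rpow (hy0 j) hY.le] at this
      have hp : 0 < X ^ (1 - θ) := Real.rpow_pos_of_pos hX _
      have hq : 0 < Y ^ θ := Real.rpow_pos_of_pos hY _
      calc x j ^ (1 - θ) * y j ^ θ
          = X ^ (1 - θ) * Y ^ θ * (x j ^ (1 - θ) / X ^ (1 - θ) * (y j ^ θ / Y ^ θ)) := by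
            field_simp
        _ ≤ _ := by gcongr
    have hs : HasSum (fun j => X ^ (1 - θ) * Y ^ θ * ((1 - θ) * (x j / X) + θ * (y j / Y)))
        (X ^ (1 - θ) * Y ^ θ * ((1 - θ) * (X / X) + θ * (Y / Y))) :=
      (((hsx.hasSum.div_const X).mul_left _).add ((hy.hasSum.div_const Y).mul_left _)).mul_left _
    have hsum : Summable (fun j => x j ^ (1 - θ) * y j ^ θ) :=
      Summable.of_nonneg_of_le
        (fun j => mul_nonneg (Real.rpow_nonneg (hx j) _) (Real.rpow_nonneg (hy0 j) _)) key
        hs.summable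
    refine ⟨hsum, ?_⟩
    have := hsum.tsum_le_tsum key hs.summable
    rw [hs.tsum_eq, div_self hX.ne', div_self hY.ne'] at this
    simpa using this

lemma one_le_two_rpow_aux {a : ℝ} (ha : 0 ≤ a) : (1:ℝ) ≤ 2 ^ a :=
  Real.one_le_rpow (by norm_num) ha

lemma summable_zero_aux (v : ℕ → ℝ) (hv : Summable (fun j : ℕ => (2:ℝ) ^ (2 * (j:ℝ)) * v j ^ 2)) :
    Summable (fun j : ℕ => v j ^ 2) :=
  Summable.of_nonneg_of_le (fun j => sq_nonneg _)
    (fun j => le_mul_of_one_le_left (sq_nonneg _) (one_le_two_rpow_aux (by positivity))) hv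

lemma Hnorm_one_sq (v : ℕ → ℝ) :
    Hnorm 1 v = Real.sqrt (∑' j : ℕ, (2:ℝ) ^ (2 * (j:ℝ)) * v j ^ 2) := by
  simp [Hnorm]

lemma Hnorm_zero_sq (v : ℕ → ℝ) : Hnorm 0 v = Real.sqrt (∑' j : ℕ, v j ^ 2) := by
  simp [Hnorm]

lemma Hnorm_nonneg_aux (a : ℝ) (v : ℕ → ℝ) : 0 ≤ Hnorm a v := Real.sqrt_nonneg _

lemma le_Hnorm_one (v : ℕ → ℝ) (hv : Summable (fun j : ℕ => (2:ℝ) ^ (2 * (j:ℝ)) * v j ^ 2))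
    (j : ℕ) : (2:ℝ) ^ (j:ℝ) * |v j| ≤ Hnorm 1 v := by
  rw [Hnorm_one_sq]
  apply Real.le_sqrt_of_sq_le
  have := hv.le_tsum j (fun i _ => by positivity)
  refine le_trans (le_of_eq ?_) this
  rw [mul_pow, sq_abs, mul_comm 2 (j:ℝ), Real.rpow_mul (by norm_num)]
  norm_num

lemma le_Hnorm_zero (v : ℕ → ℝ) (hv : Summable (fun j : ℕ => (2:ℝ) ^ (2 * (j:ℝ)) * v j ^ 2))
    (j : ℕ) : |v j| ≤ Hnorm 0 v := by
  rw [Hnorm_zero_sq]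
  apply Real.le_sqrt_of_sq_le
  rw [sq_abs]
  exact (summable_zero_aux v hv).le_tsum j (fun i _ => sq_nonneg _)

lemma interp_H (c : ℝ) (hc : c ∈ Set.Icc (1:ℝ) 2) (v : ℕ → ℝ)
    (hv : Summable (fun j : ℕ => (2:ℝ) ^ (2 * (j:ℝ)) * v j ^ 2)) :
    Summable (fun j : ℕ => (2:ℝ) ^ ((c - 1) * (j:ℝ)) * v j ^ 2) ∧
    ∑' j : ℕ, (2:ℝ) ^ ((c - 1) * (j:ℝ)) * v j ^ 2
      ≤ Hnorm 1 v ^ (c - 1) * Hnorm 0 v ^ (3 - c) := by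
  obtain ⟨hc1, hc2⟩ := hc
  have h := interp_aux (fun j => v j ^ 2) (fun j => (2:ℝ) ^ (2 * (j:ℝ)) * v j ^ 2) ((c - 1) / 2)
    (by linarith) (by linarith) (fun j => sq_nonneg _)
    (fun j => le_mul_of_one_le_left (sq_nonneg _) (one_le_two_rpow_aux (by positivity))) hv
  have e : (fun j : ℕ => (v j ^ 2) ^ (1 - (c - 1) / 2)
      * ((2:ℝ) ^ (2 * (j:ℝ)) * v j ^ 2) ^ ((c - 1) / 2))
      = fun j : ℕ => (2:ℝ) ^ ((c - 1) * (j:ℝ)) * v j ^ 2 := by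
    funext j
    rw [Real.mul_rpow (by positivity) (by positivity), ← Real.rpow_mul (by norm_num),
      mul_left_comm, ← Real.rpow_add_of_nonneg (sq_nonneg _) (by linarith) (by linarith)]
    congr 1
    · congr 1; ring
    · simp
  rw [e] at h
  refine ⟨h.1, h.2.trans (le_of_eq ?_)⟩
  rw [Hnorm_one_sq, Hnorm_zero_sq, Real.sqrt_eq_rpow, Real.sqrt_eq_rpow,
    ← Real.rpow_mul (tsum_nonneg fun j => by positivity),
    ← Real.rpow_mul (tsum_nonneg fun j => by positivity), mul_comm]
  congr 2 <;> ring

lemma high_est (c : ℝ) (hc : c ∈ Set.Icc (1:ℝ) 2) (u h : ℕ → ℝ)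
    (hu : Summable (fun j : ℕ => (2:ℝ) ^ (2 * (j:ℝ)) * u j ^ 2))
    (hh : Summable (fun j : ℕ => (2:ℝ) ^ (2 * (j:ℝ)) * h j ^ 2)) :
    Summable (fun j : ℕ => |Bop c h u j * h j|) ∧
    |∑' j : ℕ, Bop c h u j * h j|
        ≤ 2 * Hnorm 1 u * (Hnorm 1 h) ^ (c - 1) * (Hnorm 0 h) ^ ((3:ℝ) - c) := by
  obtain ⟨hs, hle⟩ := interp_H c hc h hh
  set g : ℕ → ℝ := fun j : ℕ => (2:ℝ) ^ ((c - 1) * (j:ℝ)) * h j ^ 2 with hg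
  have hg0 : ∀ j, 0 ≤ g j := fun j => by simp only [hg]; positivity
  set U := Hnorm 1 u with hU
  have hU0 : 0 ≤ U := Hnorm_nonneg_aux _ _
  let G : ℕ → ℝ := fun j => Nat.casesOn j 0 g
  have hG0 : HasSum G (∑' j, g j) := by
    rw [← hasSum_nat_add_iff' 1]
    simpa [G] using hs.hasSum
  have hpow : ∀ j : ℕ, (2:ℝ) ^ (c * (j:ℝ)) = 2 ^ ((c - 1) * (j:ℝ)) * 2 ^ (j:ℝ) := by
    intro j
    rw [← Real.rpow_add (by norm_num)]; congr 1; ring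
  have first : ∀ j : ℕ, |(2:ℝ) ^ (c * (j:ℝ)) * h j * u (j+1) * h j| ≤ U * g j := by
    intro j
    have h1 : (2:ℝ) ^ (j:ℝ) * |u (j+1)| ≤ U := by
      refine le_trans ?_ (le_Hnorm_one u hu (j+1))
      gcongr
      · norm_num
      · simp
    calc |(2:ℝ) ^ (c * (j:ℝ)) * h j * u (j+1) * h j|
        = ((2:ℝ) ^ (j:ℝ) * |u (j+1)|) * g j := by
          simp only [hg]
          rw [abs_mul, abs_mul, abs_mul, hpow, abs_of_pos (by positivity), ← sq_abs (h j)]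
          ring
      _ ≤ U * g j := mul_le_mul_of_nonneg_right h1 (hg0 j)
  have second : ∀ j : ℕ, |(2:ℝ) ^ (c * (j:ℝ)) * h j * u j * h (j+1)|
      ≤ U * ((g j + g (j+1)) / 2) := by
    intro j
    have hw : (2:ℝ) ^ ((c - 1) * (j:ℝ)) ≤ 2 ^ ((c - 1) * ((j+1 : ℕ):ℝ)) := by
      apply Real.rpow_le_rpow_of_exponent_le (by norm_num)
      apply mul_le_mul_of_nonneg_left _ (by linarith [hc.1])
      push_cast; linarith
    have hp : 0 < (2:ℝ) ^ ((c - 1) * (j:ℝ)) := by positivity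
    calc |(2:ℝ) ^ (c * (j:ℝ)) * h j * u j * h (j+1)|
        = ((2:ℝ) ^ (j:ℝ) * |u j|) * (2 ^ ((c - 1) * (j:ℝ)) * (|h j| * |h (j+1)|)) := by
          rw [abs_mul, abs_mul, abs_mul, hpow, abs_of_pos (by positivity)]
          ring
      _ ≤ U * ((g j + g (j+1)) / 2) := by
          refine mul_le_mul (le_Hnorm_one u hu j) ?_ (by positivity) hU0
          have a1 := mul_le_mul_of_nonneg_left (two_mul_le_add_sq (|h j|) (|h (j+1)|)) hp.le
          have a2 := mul_le_mul_of_nonneg_right hw (sq_nonneg (h (j+1)))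
          simp only [sq_abs] at a1
          simp only [hg]
          linarith
  have key : ∀ j, |Bop c h u j * h j| ≤ U * (g j + (G j + g j) / 2) := by
    intro j
    cases j with
    | zero =>
      have := first 0
      have h3 := mul_nonneg hU0 (hg0 0)
      have hGz : G 0 = 0 := rfl
      rw [hGz]
      simp only [Bop, if_true, sub_zero]
      refine this.trans ?_
      linarith
    | succ k =>
      have f1 := first (k+1)
      have f2 := second k
      have e : Bop c h u (k+1) * h (k+1) =
          (2:ℝ) ^ (c * ((k+1 : ℕ):ℝ)) * h (k+1) * u (k+1+1) * h (k+1)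
            - (2:ℝ) ^ (c * (k:ℝ)) * h k * u k * h (k+1) := by
        simp [Bop]; ring
      rw [e]
      refine (abs_sub _ _).trans ?_
      simp only [G]
      linarith
  have hS : HasSum (fun j => U * (g j + (G j + g j) / 2))
      (U * ((∑' j, g j) + ((∑' j, g j) + (∑' j, g j)) / 2)) :=
    (hs.hasSum.add ((hG0.add hs.hasSum).div_const 2)).mul_left U
  have hsum : Summable (fun j : ℕ => |Bop c h u j * h j|) :=
    Summable.of_nonneg_of_le (fun j => abs_nonneg _) key hS.summable
  refine ⟨hsum, ?_⟩
  have t1 : |∑' j : ℕ, Bop c h u j * h j| ≤ ∑' j, |Bop c h u j * h j| := by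
    exact norm_tsum_le_tsum_norm (f := fun j => Bop c h u j * h j) hsum
  have t2 := hsum.tsum_le_tsum key hS.summable
  rw [hS.tsum_eq] at t2
  have t3 := mul_le_mul_of_nonneg_left hle hU0
  nlinarith

lemma low_eq (c : ℝ) (N : ℕ) (u ρ : ℕ → ℝ) (j : ℕ) (hj : j ≠ N + 1) :
    Bop c u (lowPart N ρ) j * highPart N ρ j = 0 ∧
    Bop c (lowPart N ρ) u j * highPart N ρ j = 0 := by
  by_cases h : j ≤ N
  · simp [highPart, lowPart, h]
  · have h1 : ¬ (j + 1 ≤ N) := by omega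
    have h2 : ¬ (j - 1 ≤ N) := by omega
    simp [Bop, lowPart, h, h1, h2]

lemma low_eq_at (c : ℝ) (N : ℕ) (u ρ : ℕ → ℝ) :
    Bop c u (lowPart N ρ) (N+1) * highPart N ρ (N+1)
      = -((2:ℝ) ^ (c * (N:ℝ)) * u N * lowPart N ρ N * highPart N ρ (N+1)) ∧
    Bop c (lowPart N ρ) u (N+1) * highPart N ρ (N+1)
      = -((2:ℝ) ^ (c * (N:ℝ)) * u N * lowPart N ρ N * highPart N ρ (N+1)) := by
  constructor
  · simp [Bop, lowPart]
  · simp [Bop, lowPart]; left; ring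

lemma low_pt (c : ℝ) (hc : c ∈ Set.Icc (1:ℝ) 2) (N : ℕ) (u l h : ℕ → ℝ)
    (hu : Summable (fun j : ℕ => (2:ℝ) ^ (2 * (j:ℝ)) * u j ^ 2))
    (hl : Summable (fun j : ℕ => (2:ℝ) ^ (2 * (j:ℝ)) * l j ^ 2))
    (hh : Summable (fun j : ℕ => (2:ℝ) ^ (2 * (j:ℝ)) * h j ^ 2)) :
    |(2:ℝ) ^ (c * (N:ℝ)) * u N * l N * h (N+1)| ≤
      Hnorm 1 u * Hnorm 0 h * (Hnorm 0 l) ^ ((2:ℝ) - c) * (Hnorm 1 l) ^ (c - 1) := by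
  obtain ⟨hc1, hc2⟩ := hc
  have e : |(2:ℝ) ^ (c * (N:ℝ)) * u N * l N * h (N+1)| =
      ((2:ℝ) ^ (N:ℝ) * |u N|) * |h (N+1)| * |l N| ^ (2 - c) * ((2:ℝ) ^ (N:ℝ) * |l N|) ^ (c - 1) := by
    have e1 : |l N| = |l N| ^ (2 - c) * |l N| ^ (c - 1) := by
      rw [← Real.rpow_add_of_nonneg (abs_nonneg _) (by linarith) (by linarith)]
      ring_nf
      simp
    have e2 : (2:ℝ) ^ (c * (N:ℝ)) = 2 ^ (N:ℝ) * (2 ^ (N:ℝ)) ^ (c - 1) := by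
      rw [← Real.rpow_mul (by norm_num), ← Real.rpow_add (by norm_num)]
      congr 1; ring
    rw [Real.mul_rpow (by positivity) (abs_nonneg _), abs_mul, abs_mul, abs_mul,
      abs_of_pos (by positivity : (0:ℝ) < 2 ^ (c * (N:ℝ))), e2]
    nth_rewrite 1 [e1]
    ring
  rw [e]
  have n1 := Hnorm_nonneg_aux 1 u
  have n2 := Hnorm_nonneg_aux 0 h
  have n3 := Hnorm_nonneg_aux 0 l
  have n4 := Hnorm_nonneg_aux 1 l
  have a1 := le_Hnorm_one u hu N
  have a2 := le_Hnorm_zero h hh (N+1)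
  have a3 := Real.rpow_le_rpow (abs_nonneg _) (le_Hnorm_zero l hl N) (by linarith : 0 ≤ 2 - c)
  have a4 := Real.rpow_le_rpow (by positivity) (le_Hnorm_one l hl N) (by linarith : 0 ≤ c - 1)
  gcongr


theorem stmt16 (c : ℝ) (hc : c ∈ Set.Icc (1:ℝ) 2) :
    ∃ C : ℝ, 0 < C ∧
      ∀ (N : ℕ) (u ρ : ℕ → ℝ),
      Summable (fun j : ℕ => (2:ℝ) ^ (2 * (j:ℝ)) * u j ^ 2) →
      Summable (fun j : ℕ => (2:ℝ) ^ (2 * (j:ℝ)) * ρ j ^ 2) →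
      Summable (fun j : ℕ => |Bop c u (lowPart N ρ) j * highPart N ρ j|) ∧
      Summable (fun j : ℕ => |Bop c (lowPart N ρ) u j * highPart N ρ j|) ∧
      Summable (fun j : ℕ => |Bop c (highPart N ρ) u j * highPart N ρ j|) ∧
      |∑' j : ℕ, Bop c u (lowPart N ρ) j * highPart N ρ j|
          + |∑' j : ℕ, Bop c (lowPart N ρ) u j * highPart N ρ j|
        ≤ C * Hnorm 1 u * Hnorm 0 (highPart N ρ)
            * (Hnorm 0 (lowPart N ρ)) ^ ((2:ℝ) - c)
            * (Hnorm 1 (lowPart N ρ)) ^ (c - 1) ∧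
      |∑' j : ℕ, Bop c (highPart N ρ) u j * highPart N ρ j|
        ≤ C * Hnorm 1 u * (Hnorm 1 (highPart N ρ)) ^ (c - 1)
            * (Hnorm 0 (highPart N ρ)) ^ ((3:ℝ) - c) := by
  refine ⟨2, by norm_num, ?_⟩
  intro N u ρ hu hρ
  have hl : Summable (fun j : ℕ => (2:ℝ) ^ (2 * (j:ℝ)) * lowPart N ρ j ^ 2) := by
    refine Summable.of_nonneg_of_le (fun j => by positivity) (fun j => ?_) hρ
    by_cases h : j ≤ N
    · simp [lowPart, h]
    · simp only [lowPart, h, if_false]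
      have : (0:ℝ) ≤ (2:ℝ) ^ (2 * (j:ℝ)) * ρ j ^ 2 := by positivity
      simpa using this
  have hh : Summable (fun j : ℕ => (2:ℝ) ^ (2 * (j:ℝ)) * highPart N ρ j ^ 2) := by
    refine Summable.of_nonneg_of_le (fun j => by positivity) (fun j => ?_) hρ
    by_cases h : j ≤ N
    · simp only [highPart, lowPart, h, if_true, sub_self]
      have : (0:ℝ) ≤ (2:ℝ) ^ (2 * (j:ℝ)) * ρ j ^ 2 := by positivity
      simpa using this
    · simp [highPart, lowPart, h]
  obtain ⟨hs3, hb3⟩ := high_est c hc u (highPart N ρ) hu hh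
  have hpt := low_pt c hc N u (lowPart N ρ) (highPart N ρ) hu hl hh
  obtain ⟨e1, e2⟩ := low_eq_at c N u ρ
  refine ⟨?_, ?_, hs3, ?_, hb3⟩
  · refine summable_of_ne_finset_zero (s := {N + 1}) (fun j hj => ?_)
    rw [(low_eq c N u ρ j (by simpa using hj)).1, abs_zero]
  · refine summable_of_ne_finset_zero (s := {N + 1}) (fun j hj => ?_)
    rw [(low_eq c N u ρ j (by simpa using hj)).2, abs_zero]
  · rw [tsum_eq_single (N + 1) (fun j hj => (low_eq c N u ρ j hj).1),
      tsum_eq_single (N + 1) (fun j hj => (low_eq c N u ρ j hj).2), e1, e2, abs_neg]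
    linarith
end

section
/- Let c ∈ ℝ and let u = (u_j)_{j≥0} be a real sequence with u_j ≥ 0 for every j ≥ 1 (u₀ arbitrary, convention u_{-1} := 0). Then for every N ≥ 0, Σ_{j=0}^N 2^{-j} u_j ( 2^{cj} u_j u_{j+1} - 2^{c(j-1)} u_{j-1}² ) = 2^{(c-1)N} u_N² u_{N+1} + (1/2) Σ_{j=0}^{N-1} 2^{(c-1)j} u_j² u_{j+1} ≥ 0. -/
theorem stmt18 (c : ℝ) (u : ℕ → ℝ) (hpos : ∀ j : ℕ, 1 ≤ j → 0 ≤ u j) :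
    ∀ N : ℕ,
      (∑ j ∈ Finset.range (N+1), (2:ℝ) ^ (-(j:ℝ)) * u j *
          ((2:ℝ) ^ (c * (j:ℝ)) * u j * u (j+1)
            - (if j = 0 then 0 else (2:ℝ) ^ (c * ((j:ℝ) - 1)) * (u (j-1)) ^ 2)))
        = (2:ℝ) ^ ((c-1) * (N:ℝ)) * (u N) ^ 2 * u (N+1)
          + (1/2) * ∑ j ∈ Finset.range N, (2:ℝ) ^ ((c-1) * (j:ℝ)) * (u j) ^ 2 * u (j+1) ∧
      0 ≤ ∑ j ∈ Finset.range (N+1), (2:ℝ) ^ (-(j:ℝ)) * u j *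
          ((2:ℝ) ^ (c * (j:ℝ)) * u j * u (j+1)
            - (if j = 0 then 0 else (2:ℝ) ^ (c * ((j:ℝ) - 1)) * (u (j-1)) ^ 2)) := by
  intro N
  have key : (∑ j ∈ Finset.range (N+1), (2:ℝ) ^ (-(j:ℝ)) * u j *
          ((2:ℝ) ^ (c * (j:ℝ)) * u j * u (j+1)
            - (if j = 0 then 0 else (2:ℝ) ^ (c * ((j:ℝ) - 1)) * (u (j-1)) ^ 2)))
        = (2:ℝ) ^ ((c-1) * (N:ℝ)) * (u N) ^ 2 * u (N+1)
          + (1/2) * ∑ j ∈ Finset.range N, (2:ℝ) ^ ((c-1) * (j:ℝ)) * (u j) ^ 2 * u (j+1) := by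
    induction N with
    | zero => simp; ring
    | succ n ih =>
      rw [Finset.sum_range_succ, ih, Finset.sum_range_succ _ n]
      have h1 : (2:ℝ) ^ ((c-1) * ((n+1 : ℕ):ℝ))
          = (2:ℝ) ^ (-((n+1 : ℕ):ℝ)) * (2:ℝ) ^ (c * ((n+1 : ℕ):ℝ)) := by
        rw [← Real.rpow_add (by norm_num)]
        congr 1
        ring
      have h2 : (2:ℝ) ^ (-((n+1 : ℕ):ℝ)) * (2:ℝ) ^ (c * (((n+1 : ℕ):ℝ) - 1))
          = (1/2) * (2:ℝ) ^ ((c-1) * (n:ℝ)) := by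
        have h3 : (1/2 : ℝ) = (2:ℝ) ^ (-1 : ℝ) := by
          rw [Real.rpow_neg_one]; norm_num
        rw [h3, ← Real.rpow_add (by norm_num), ← Real.rpow_add (by norm_num)]
        congr 1
        push_cast
        ring
      rw [h1, if_neg (Nat.succ_ne_zero n), Nat.add_sub_cancel]
      linear_combination (-(u (n+1) * u n ^ 2)) * h2
  refine ⟨key, ?_⟩
  rw [key]
  have hnn : ∀ j : ℕ, 0 ≤ (2:ℝ) ^ ((c-1) * (j:ℝ)) * (u j) ^ 2 * u (j+1) := fun j =>
    mul_nonneg (by positivity) (hpos (j+1) (Nat.le_add_left 1 j))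
  have hs := Finset.sum_nonneg (s := Finset.range N) (fun j _ => hnn j)
  linarith [hnn N, hs]
end

section
/- Let (Ω, 𝓕, ℙ) be a probability space with a filtration (𝓕_n)_{n≥0}, let q > 0 and δ ≥ 0, and let (X_n)_{n≥0} and (G_n)_{n≥0} be random variables such that: X_n ≥ 0, X_n is 𝓕_n-measurable, and 𝔼(X_n^{2q}) < ∞ for every n; G_n > 0 almost surely, G_n is 𝓕_n-measurable, and 𝔼( Π_{k=0}^{n-1} G_k ) < ∞ for every n ≥ 1; and for every n ≥ 0, 𝔼( X_{n+1}^{2q} | 𝓕_n ) ≤ δ² G_n X_n^{2q} almost surely. Then for every n ≥ 1, 𝔼( X_n^q ) ≤ δ^n ( 𝔼( X_0^{2q} ) )^{1/2} ( 𝔼( Π_{k=0}^{n-1} G_k ) )^{1/2}. -/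
open MeasureTheory

theorem aux_step_s19 {Ω : Type*} {m m0 : MeasurableSpace Ω} (hm : m ≤ m0) (μ : Measure Ω)
    [IsProbabilityMeasure μ] (Y Z : Ω → ℝ) (hY : Integrable Y μ) (hY0 : 0 ≤ᵐ[μ] Y)
    (hYm : Measurable[m0] Y) (hZm : Measurable[m0] Z)
    (h : μ[Y | m] ≤ᵐ[μ] Z) (f : Ω → ENNReal) (hf : Measurable[m] f) :
    ∫⁻ ω, ENNReal.ofReal (Y ω) * f ω ∂μ ≤ ∫⁻ ω, ENNReal.ofReal (Z ω) * f ω ∂μ := by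
  have hf0 : Measurable[m0] f := hf.mono hm le_rfl
  have e1 := lintegral_withDensity_eq_lintegral_mul μ (hYm.ennreal_ofReal) hf0
  have e2 := lintegral_withDensity_eq_lintegral_mul μ (hZm.ennreal_ofReal) hf0
  simp only [Pi.mul_apply] at e1 e2
  rw [← e1, ← e2, ← lintegral_trim hm hf, ← lintegral_trim hm hf]
  refine lintegral_mono' ?_ le_rfl
  refine Measure.le_iff.2 fun s hs => ?_
  rw [trim_measurableSet_eq hm hs, trim_measurableSet_eq hm hs,
    withDensity_apply _ (hm s hs), withDensity_apply _ (hm s hs),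
    ← ofReal_integral_eq_lintegral_ofReal hY.integrableOn (ae_restrict_of_ae hY0),
    ← setIntegral_condExp hm hY hs,
    ofReal_integral_eq_lintegral_ofReal integrable_condExp.integrableOn
      (ae_restrict_of_ae (condExp_nonneg hY0))]
  refine lintegral_mono_ae (ae_restrict_of_ae ?_)
  filter_upwards [h] with ω hω
  exact ENNReal.ofReal_le_ofReal hω

theorem stmt19 {Ω : Type*} {m0 : MeasurableSpace Ω} (μ : Measure Ω) [IsProbabilityMeasure μ]
    (ℱ : Filtration ℕ m0) (q δ : ℝ) (hq : 0 < q) (hδ : 0 ≤ δ)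
    (X G : ℕ → Ω → ℝ)
    (hXpos : ∀ n, ∀ᵐ ω ∂μ, 0 ≤ X n ω)
    (hXmeas : ∀ n, StronglyMeasurable[ℱ n] (X n))
    (hXint : ∀ n, Integrable (fun ω => X n ω ^ (2 * q)) μ)
    (hGpos : ∀ n, ∀ᵐ ω ∂μ, 0 < G n ω)
    (hGmeas : ∀ n, StronglyMeasurable[ℱ n] (G n))
    (hGint : ∀ n : ℕ, 1 ≤ n → Integrable (fun ω => ∏ k ∈ Finset.range n, G k ω) μ)
    (hstep : ∀ n : ℕ,
      μ[(fun ω => X (n+1) ω ^ (2 * q)) | ℱ n]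
        ≤ᵐ[μ] fun ω => δ ^ 2 * G n ω * X n ω ^ (2 * q)) :
    ∀ n : ℕ, 1 ≤ n →
      (∫ ω, X n ω ^ q ∂μ)
        ≤ δ ^ n * (∫ ω, X 0 ω ^ (2 * q) ∂μ) ^ ((1:ℝ)/2)
            * (∫ ω, ∏ k ∈ Finset.range n, G k ω ∂μ) ^ ((1:ℝ)/2) := by
  have hXm : ∀ n, Measurable[m0] (X n) := fun n => (hXmeas n).measurable.mono (ℱ.le n) le_rfl
  have hGm : ∀ n, Measurable[m0] (G n) := fun n => (hGmeas n).measurable.mono (ℱ.le n) le_rfl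
  have hYm : ∀ n, Measurable[m0] (fun ω => X n ω ^ (2 * q)) := fun n => (hXm n).pow_const _
  have hY0 : ∀ n, 0 ≤ᵐ[μ] (fun ω => X n ω ^ (2 * q)) := fun n => by
    filter_upwards [hXpos n] with ω h
    exact Real.rpow_nonneg h _
  have hPm : ∀ n, Measurable[m0] (fun ω => ∏ k ∈ Finset.range n, G k ω) := fun n =>
    Finset.measurable_fun_prod _ fun k _ => hGm k
  have hG : ∀ᵐ ω ∂μ, ∀ n, 0 < G n ω := ae_all_iff.2 hGpos
  have key : ∀ n, ∫⁻ ω, ENNReal.ofReal (X n ω ^ (2 * q))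
        * ENNReal.ofReal ((∏ k ∈ Finset.range n, G k ω)⁻¹) ∂μ
      ≤ ENNReal.ofReal (δ ^ (2 * n) * ∫ ω, X 0 ω ^ (2 * q) ∂μ) := by
    intro n
    induction n with
    | zero =>
      simp [ofReal_integral_eq_lintegral_ofReal (hXint 0) (hY0 0)]
    | succ n ih =>
      have hPmn : Measurable[ℱ n] (fun ω =>
          ENNReal.ofReal ((∏ k ∈ Finset.range (n+1), G k ω)⁻¹)) := by
        refine Measurable.ennreal_ofReal (Measurable.inv ?_)
        refine Finset.measurable_fun_prod _ fun k hk => ?_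
        exact (hGmeas k).measurable.mono
          (ℱ.mono (Nat.lt_succ_iff.1 (Finset.mem_range.1 hk))) le_rfl
      refine (aux_step_s19 (ℱ.le n) μ _ _ (hXint (n+1)) (hY0 (n+1)) (hYm (n+1))
        (((hGm n).const_mul _).mul (hYm n)) (hstep n) _ hPmn).trans ?_
      have : ∫⁻ ω, ENNReal.ofReal (δ ^ 2 * G n ω * X n ω ^ (2 * q))
          * ENNReal.ofReal ((∏ k ∈ Finset.range (n+1), G k ω)⁻¹) ∂μ
          = ∫⁻ ω, ENNReal.ofReal (δ ^ 2) * (ENNReal.ofReal (X n ω ^ (2 * q))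
        * ENNReal.ofReal ((∏ k ∈ Finset.range n, G k ω)⁻¹)) ∂μ := by
        refine lintegral_congr_ae ?_
        filter_upwards [hG, hY0 n] with ω h1 h2
        have h2 : 0 ≤ X n ω ^ (2 * q) := h2
        have h3 : 0 < ∏ k ∈ Finset.range n, G k ω := Finset.prod_pos fun k _ => h1 k
        have h4 := h1 n
        rw [← ENNReal.ofReal_mul (by positivity), ← ENNReal.ofReal_mul (by positivity),
          ← ENNReal.ofReal_mul (by positivity), Finset.prod_range_succ]
        congr 1
        field_simp
      refine this.le.trans ?_
      rw [lintegral_const_mul _ (by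
        exact (hYm n).ennreal_ofReal.mul (hPm n).inv.ennreal_ofReal)]
      refine (mul_le_mul_right ih _).trans ?_
      rw [← ENNReal.ofReal_mul (by positivity)]
      refine ENNReal.ofReal_le_ofReal (le_of_eq ?_)
      ring
  intro n hn
  have hI0 : 0 ≤ ∫ ω, X 0 ω ^ (2 * q) ∂μ := integral_nonneg_of_ae (hY0 0)
  have hP0 : 0 ≤ᵐ[μ] (fun ω => ∏ k ∈ Finset.range n, G k ω) := by
    filter_upwards [hG] with ω h
    exact Finset.prod_nonneg fun k _ => (h k).le
  have hJ0 : 0 ≤ ∫ ω, ∏ k ∈ Finset.range n, G k ω ∂μ := integral_nonneg_of_ae hP0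
  rw [integral_eq_lintegral_of_nonneg_ae (by
    filter_upwards [hXpos n] with ω h
    exact Real.rpow_nonneg h _) ((hXm n).pow_const q).aestronglyMeasurable]
  refine ENNReal.toReal_le_of_le_ofReal (by positivity) ?_
  have hCS := ENNReal.lintegral_mul_le_Lp_mul_Lq μ Real.HolderConjugate.two_two
    (f := fun ω => (ENNReal.ofReal (X n ω ^ (2 * q))
        * ENNReal.ofReal ((∏ k ∈ Finset.range n, G k ω)⁻¹)) ^ ((1:ℝ)/2))
    (g := fun ω => (ENNReal.ofReal (∏ k ∈ Finset.range n, G k ω)) ^ ((1:ℝ)/2))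
    (((hYm n).ennreal_ofReal.mul (hPm n).inv.ennreal_ofReal).pow_const _).aemeasurable
    ((hPm n).ennreal_ofReal.pow_const _).aemeasurable
  simp only [← ENNReal.rpow_mul] at hCS
  norm_num only [ENNReal.rpow_one] at hCS
  calc ∫⁻ ω, ENNReal.ofReal (X n ω ^ q) ∂μ
      = _ := ?_
    _ ≤ _ := hCS
    _ ≤ ENNReal.ofReal (δ ^ (2 * n) * ∫ ω, X 0 ω ^ (2 * q) ∂μ) ^ ((1:ℝ)/2)
        * ENNReal.ofReal (∫ ω, ∏ k ∈ Finset.range n, G k ω ∂μ) ^ ((1:ℝ)/2) := ?_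
    _ = _ := ?_
  · refine lintegral_congr_ae ?_
    filter_upwards [hG, hXpos n] with ω h1 h2
    have h3 : 0 < ∏ k ∈ Finset.range n, G k ω := Finset.prod_pos fun k _ => h1 k
    have h4 : 0 ≤ X n ω ^ (2 * q) := Real.rpow_nonneg h2 _
    simp only [Pi.mul_apply]
    rw [← ENNReal.mul_rpow_of_nonneg _ _ (by norm_num), ← ENNReal.ofReal_mul h4,
      ← ENNReal.ofReal_mul (by positivity), mul_assoc, inv_mul_cancel₀ h3.ne', mul_one,
      ENNReal.ofReal_rpow_of_nonneg h4 (by norm_num), ← Real.rpow_mul h2]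
    congr 2
    ring
  · rw [ofReal_integral_eq_lintegral_ofReal (hGint n hn) hP0]
    exact mul_le_mul_left (ENNReal.rpow_le_rpow (key n) (by norm_num)) _
  · rw [ENNReal.ofReal_rpow_of_nonneg (by positivity) (by norm_num),
      ENNReal.ofReal_rpow_of_nonneg hJ0 (by norm_num), ← ENNReal.ofReal_mul (by positivity),
      Real.mul_rpow (by positivity) hI0]
    congr 3
    rw [mul_comm 2 n, pow_mul, ← Real.sqrt_eq_rpow, Real.sqrt_sq (by positivity)]
end
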